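/- arXiv:2201.07270 — 5 statements merged into one kernel-verified Lean document; each statement's English description precedes it below -/
import Mathlib

section
/- Let k ≥ 1 be an integer and μ, η > 0 real. Then the polynomial P_k admits a decomposition P_k(z_1,…,z_k) = (z_1+η)·F_1(z_1,…,z_k) + ∑_{i=2}^{k} (z_{i−1}−z_i−1)·F_i(z_1,…,z_k), where F_1 ∈ ℂ[z_1,…,z_k] is symmetric with respect to z_1 ↔ −z_1 (i.e. invariant under the substitution z_1 ↦ −z_1), and for each 2 ≤ i ≤ k, F_i ∈ ℂ[z_1,…,z_k] is symmetric with respect to exchanging z_{i−1} and z_i. -/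
open MvPolynomial

/-- The polynomial `P_k` from the paper (eq. (2.3)):
`P_k(z) = ∏ z_i² − (∏ (z_i−μ)) · ∑_{i=0}^k C(k,i) (μ)_i (η)_{k−i}/(η+μ)_k
  · ∏_{ℓ=1}^{k−i}(z_ℓ+μ) · ∏_{j=k−i+1}^k z_j`. -/
noncomputable def Ppoly (k : ℕ) (μ η : ℝ) : MvPolynomial (Fin k) ℂ :=
  (∏ i, (X i) ^ 2) -
    (∏ i, (X i - C (μ : ℂ))) *
      ∑ i ∈ Finset.range (k + 1),
        C ((k.choose i : ℂ) * ((ascPochhammer ℝ i).eval μ : ℝ) *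
            ((ascPochhammer ℝ (k - i)).eval η : ℝ) / ((ascPochhammer ℝ k).eval (η + μ) : ℝ)) *
          (∏ j ∈ Finset.univ.filter (fun j : Fin k => (j : ℕ) < k - i), (X j + C (μ : ℂ))) *
          (∏ j ∈ Finset.univ.filter (fun j : Fin k => k - i ≤ (j : ℕ)), X j)

open Finset in
/-- The umbral binomial `∑ C(n,i) f i (n-i)`. -/
def binomSum {R : Type*} [CommRing R] (n : ℕ) (f : ℕ → ℕ → R) : R :=
  ∑ ij ∈ antidiagonal n, (n.choose ij.1 : R) * f ij.1 ij.2

/-- The rising factorial `a (a + 1) ⋯ (a + n - 1)`. -/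
def risingFact {R : Type*} [CommRing R] (a : R) (n : ℕ) : R :=
  ∏ i ∈ Finset.range n, (a + i)

section binomSum

variable {R : Type*} [CommRing R]

theorem binomSum_zero (f : ℕ → ℕ → R) : binomSum 0 f = f 0 0 := by
  simp [binomSum]

theorem binomSum_succ (n : ℕ) (f : ℕ → ℕ → R) :
    binomSum (n + 1) f =
      binomSum n (fun i j => f i (j + 1)) + binomSum n (fun i j => f (i + 1) j) := by
  unfold binomSum
  rw [Finset.sum_antidiagonal_choose_succ_mul]
  congr 1
  refine Finset.sum_congr rfl fun ij h => ?_
  rw [Finset.HasAntidiagonal.mem_antidiagonal] at h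
  rw [← h, Nat.choose_symm_add]

theorem binomSum_add (n : ℕ) (f g : ℕ → ℕ → R) :
    binomSum n (fun i j => f i j + g i j) = binomSum n f + binomSum n g := by
  simp [binomSum, mul_add, Finset.sum_add_distrib]

theorem binomSum_mul_left (n : ℕ) (c : R) (f : ℕ → ℕ → R) :
    binomSum n (fun i j => c * f i j) = c * binomSum n f := by
  simp only [binomSum, Finset.mul_sum, mul_left_comm]

theorem binomSum_congr {n : ℕ} {f g : ℕ → ℕ → R} (h : ∀ i j, i + j = n → f i j = g i j) :
    binomSum n f = binomSum n g :=
  Finset.sum_congr rfl fun ij hij => by rw [h _ _ (Finset.HasAntidiagonal.mem_antidiagonal.1 hij)]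

theorem binomSum_exchange (k : ℕ) (F : ℕ → ℕ → ℕ → ℕ → R) :
    binomSum k (fun m l => binomSum m fun p j => binomSum l fun q j' => F p j q j') =
      binomSum k (fun r s => binomSum r fun p q => binomSum s fun j j' => F p j q j') := by
  induction k generalizing F with
  | zero => simp [binomSum_zero]
  | succ k ih =>
    have h1 := ih fun p j q j' => F (p + 1) j q j'
    have h2 := ih fun p j q j' => F p (j + 1) q j'
    have h3 := ih fun p j q j' => F p j (q + 1) j'
    have h4 := ih fun p j q j' => F p j q (j' + 1)
    simp only [binomSum_succ, binomSum_add]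
    rw [h1, h2, h3, h4]
    ring

theorem risingFact_succ (a : R) (n : ℕ) :
    risingFact a (n + 1) = risingFact a n * (a + n) :=
  Finset.prod_range_succ _ _

theorem risingFact_add (a : R) (m n : ℕ) :
    risingFact a (m + n) = risingFact a m * risingFact (a + m) n := by
  simp [risingFact, Finset.prod_range_add, add_assoc]

/-- The Chu–Vandermonde identity. -/
theorem binomSum_risingFact (a b : R) (n : ℕ) :
    binomSum n (fun i j => risingFact a i * risingFact b j) = risingFact (a + b) n := by
  induction n with
  | zero => simp [binomSum_zero, risingFact]
  | succ n ih =>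
    rw [binomSum_succ, ← binomSum_add, risingFact_succ, ← ih, mul_comm, ← binomSum_mul_left]
    refine binomSum_congr fun i j h => ?_
    rw [risingFact_succ, risingFact_succ, ← h]
    push_cast
    ring

end binomSum

/-- Variables `z 0, …, z (k - 1)` in a ring, with endomorphisms `σ 0` flipping the sign of `z 0`
and `σ (i + 1)` exchanging `z i` and `z (i + 1)`, and an additive map `π` that kills
`(z 0 + η) g` for `g` fixed by `σ 0` and `(z i - z (i + 1) - 1) g` for `g` fixed by `σ (i + 1)`. -/
structure IsBoundaryQuotient {R M : Type*} [CommRing R] [AddCommGroup M] (k : ℕ) (z : ℕ → R)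
    (σ : ℕ → R →+* R) (π : R →+ M) (η : R) : Prop where
  map_eta : ∀ i, σ i η = η
  map_flip : σ 0 (z 0) = -z 0
  map_left : ∀ i, i + 1 < k → σ (i + 1) (z i) = z (i + 1)
  map_right : ∀ i, i + 1 < k → σ (i + 1) (z (i + 1)) = z i
  map_other : ∀ i j, i < k → j < k → j ≠ i → j + 1 ≠ i → σ i (z j) = z j
  boundary : ∀ g, σ 0 g = g → π ((z 0 + η) * g) = 0
  exchange : ∀ i g, i + 1 < k → σ (i + 1) g = g → π ((z i - z (i + 1) - 1) * g) = 0

namespace IsBoundaryQuotient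

variable {R M : Type*} [CommRing R] [AddCommGroup M] {k : ℕ} {z : ℕ → R}
  {σ : ℕ → R →+* R} {π : R →+ M} {η : R}

/-- The product `∏ (z i ^ 2 - η ^ 2)` over the first `j` variables. -/
def evenProd (z : ℕ → R) (η : R) (j : ℕ) : R := ∏ i ∈ Finset.range j, (z i ^ 2 - η ^ 2)

theorem evenProd_succ (j : ℕ) :
    evenProd z η (j + 1) = evenProd z η j * (z j ^ 2 - η ^ 2) :=
  Finset.prod_range_succ _ _

theorem map_evenProd_of_lt (H : IsBoundaryQuotient k z σ π η) {i j : ℕ} (hi : i < k)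
    (hji : j < i) : σ i (evenProd z η j) = evenProd z η j := by
  simp only [evenProd, map_prod, map_sub, map_pow, H.map_eta]
  refine Finset.prod_congr rfl fun l hl => ?_
  have := Finset.mem_range.1 hl
  rw [H.map_other i l hi (by omega) (by omega) (by omega)]

/-- Membership in the common fixed points of `σ 0, …, σ (n - 1)`. -/
def FixedBelow (σ : ℕ → R →+* R) (n : ℕ) (h : R) : Prop := ∀ i, i < n → σ i h = h

theorem FixedBelow.mono {m n : ℕ} {h : R} (hh : FixedBelow σ n h) (hmn : m ≤ n) :
    FixedBelow σ m h := fun i hi => hh i (hi.trans_le hmn)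

theorem FixedBelow.mul {n : ℕ} {g h : R} (hg : FixedBelow σ n g) (hh : FixedBelow σ n h) :
    FixedBelow σ n (g * h) := fun i hi => by rw [map_mul, hg i hi, hh i hi]

theorem FixedBelow.add {n : ℕ} {g h : R} (hg : FixedBelow σ n g) (hh : FixedBelow σ n h) :
    FixedBelow σ n (g + h) := fun i hi => by rw [map_add, hg i hi, hh i hi]

theorem FixedBelow.sub {n : ℕ} {g h : R} (hg : FixedBelow σ n g) (hh : FixedBelow σ n h) :
    FixedBelow σ n (g - h) := fun i hi => by rw [map_sub, hg i hi, hh i hi]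

theorem FixedBelow.neg {n : ℕ} {g : R} (hg : FixedBelow σ n g) : FixedBelow σ n (-g) :=
  fun i hi => by rw [map_neg, hg i hi]

theorem FixedBelow.pow {n : ℕ} {g : R} (hg : FixedBelow σ n g) (m : ℕ) :
    FixedBelow σ n (g ^ m) := fun i hi => by rw [map_pow, hg i hi]

theorem FixedBelow.prod {ι : Type*} {n : ℕ} {s : Finset ι} {f : ι → R}
    (hf : ∀ i ∈ s, FixedBelow σ n (f i)) : FixedBelow σ n (∏ i ∈ s, f i) := fun i hi => by
  rw [map_prod]
  exact Finset.prod_congr rfl fun l hl => hf l hl i hi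

theorem fixedBelow_natCast (n m : ℕ) : FixedBelow σ n (m : R) := fun _ _ => map_natCast _ _

theorem fixedBelow_var (H : IsBoundaryQuotient k z σ π η) {n j : ℕ} (hn : n ≤ j) (hj : j < k) :
    FixedBelow σ n (z j) := fun i hi => H.map_other i j (by omega) hj (by omega) (by omega)

theorem fixedBelow_eta (H : IsBoundaryQuotient k z σ π η) (n : ℕ) : FixedBelow σ n η :=
  fun i _ => H.map_eta i

theorem map_evenProd_mul_next (H : IsBoundaryQuotient k z σ π η) {j : ℕ} (hj : j < k) {h : R}
    (hh : FixedBelow σ (j + 1) h) : π (evenProd z η j * (z j + η) * h) = 0 := by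
  induction j generalizing h with
  | zero => simpa [evenProd] using H.boundary h (hh 0 (by omega))
  | succ j ih =>
    have hz := H.fixedBelow_var le_rfl hj
    have hη := H.fixedBelow_eta (j + 1)
    have h1 := H.exchange j (evenProd z η j * (z j + η) * (z (j + 1) + η) * h) hj (by
      simp only [map_mul, map_add, H.map_eta, H.map_left j hj, H.map_right j hj,
        H.map_evenProd_of_lt hj j.lt_succ_self, hh (j + 1) (by omega)]
      ring)
    have h2 := @ih (by omega) ((z (j + 1) + η) * (z (j + 1) + (1 : ℕ) - η) * h)
      (((hz.add hη).mul ((hz.add (fixedBelow_natCast _ 1)).sub hη)).mul (hh.mono (by omega)))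
    rw [← add_zero (0 : M)]
    nth_rewrite 1 [← h1]
    rw [← h2, ← map_add, evenProd_succ]
    congr 1
    push_cast
    ring

theorem map_evenProd_mul_var (H : IsBoundaryQuotient k z σ π η) {j r : ℕ} (hj : j + r < k) {h : R}
    (hh : FixedBelow σ (j + r + 1) h) : π (evenProd z η j * (z (j + r) + η + r) * h) = 0 := by
  induction r generalizing h with
  | zero => simpa using H.map_evenProd_mul_next hj hh
  | succ r ih =>
    have h1 := H.exchange (j + r) (evenProd z η j * h) hj (by
      rw [map_mul, H.map_evenProd_of_lt (i := j + r + 1) hj (by omega), hh _ (by omega)])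
    have h2 := ih (by omega) (hh.mono (by omega))
    rw [← sub_zero (0 : M)]
    nth_rewrite 1 [← h2]
    rw [← h1, ← map_sub, ← add_assoc]
    congr 1
    push_cast
    ring

theorem map_evenProd_mul_sq (H : IsBoundaryQuotient k z σ π η) {j r : ℕ} (hj : j + r < k) {h : R}
    (hh : FixedBelow σ (j + r + 1) h) :
    π ((evenProd z η j * (z (j + r) ^ 2 - (η + r) ^ 2) - evenProd z η (j + 1)) * h) = 0 := by
  induction r generalizing h with
  | zero => simp [evenProd_succ]
  | succ r ih =>
    have h1 := H.exchange (j + r) (evenProd z η j * (z (j + r) + z (j + r + 1)) * h) hj (by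
      rw [map_mul, map_mul, map_add, H.map_left (j + r) hj, H.map_right (j + r) hj,
        H.map_evenProd_of_lt (i := j + r + 1) hj (by omega), hh _ (by omega), add_comm (z (j + r))])
    have h2 := ih (by omega) (hh.mono (by omega))
    have h3 := H.map_evenProd_mul_var (j := j) (r := r) (by omega) (hh.mono (by omega))
    have h4 := H.map_evenProd_mul_var hj hh
    have h_sum := congr_arg₂ (· + ·) (congr_arg₂ (· + ·) h1 h3) h4
    simp only [← map_add, add_zero] at h_sum
    rw [← sub_zero (0 : M)]
    nth_rewrite 1 [← h2]
    rw [← h_sum, ← map_sub, ← add_assoc]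
    congr 1
    push_cast
    ring

theorem map_evenProd_mul_letter (H : IsBoundaryQuotient k z σ π η) {β c : R}
    (hβ : ∀ n, FixedBelow σ n β) {j r : ℕ} (hj : j + r < k)
    {h : R} (hh : FixedBelow σ (j + r + 1) h) :
    π (evenProd z η j * (z (j + r) ^ 2 + β * z (j + r) + c) * h) =
      π ((evenProd z η (j + 1) + ((η + r) ^ 2 - β * (η + r) + c) * evenProd z η j) * h) := by
  have h1 := H.map_evenProd_mul_sq hj hh
  have h2 := H.map_evenProd_mul_var hj ((hβ _).mul hh)
  rw [← sub_eq_zero, ← map_sub, ← add_zero (0 : M)]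
  nth_rewrite 1 [← h1]
  rw [← h2, ← map_add]
  congr 1
  ring

theorem map_evenProd_mul_word (H : IsBoundaryQuotient k z σ π η) {β c : R}
    (hβ : ∀ n, FixedBelow σ n β) (hc : ∀ n, FixedBelow σ n c) {j p l : ℕ} (hj : j + p + l ≤ k)
    {h : R} (hh : FixedBelow σ (j + p + l) h) :
    π (evenProd z η j *
        (∏ i ∈ Finset.range l, (z (j + p + i) ^ 2 + β * z (j + p + i) + c)) * h) =
      π (binomSum l (fun q j' =>
        (∏ i ∈ Finset.range q, ((η + (p + i : ℕ)) ^ 2 - β * (η + (p + i : ℕ)) + c)) *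
          evenProd z η (j + j')) * h) := by
  induction l generalizing h with
  | zero => simp [binomSum_zero]
  | succ l ih =>
    have hz := H.fixedBelow_var (le_refl (j + p + l)) (by omega)
    have h1 := @ih (by omega) ((z (j + p + l) ^ 2 + β * z (j + p + l) + c) * h)
      ((((hz.pow 2).add ((hβ _).mul hz)).add (hc _)).mul (hh.mono (by omega)))
    rw [Finset.prod_range_succ, ← mul_assoc, mul_assoc _ _ h, h1, binomSum_succ, ← binomSum_add]
    unfold binomSum
    rw [Finset.sum_mul, Finset.sum_mul, map_sum, map_sum]
    refine Finset.sum_congr rfl fun ij hij => ?_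
    obtain ⟨q, j'⟩ := ij
    rw [Finset.HasAntidiagonal.mem_antidiagonal] at hij
    dsimp only at hij ⊢
    set G := ∏ i ∈ Finset.range q, ((η + (p + i : ℕ)) ^ 2 - β * (η + (p + i : ℕ)) + c) with hG
    have hGf : ∀ n, FixedBelow σ n G := fun n => FixedBelow.prod fun i _ =>
      have := (H.fixedBelow_eta n).add (fixedBelow_natCast n (p + i))
      ((this.pow 2).sub ((hβ n).mul this)).add (hc n)
    have e : j + p + l = (j + j') + (p + q) := by omega
    have h2 := H.map_evenProd_mul_letter (j := j + j') (r := p + q) (c := c) hβ (by omega)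
      (h := l.choose q * G * h) (((fixedBelow_natCast _ _).mul (hGf _)).mul (hh.mono (by omega)))
    rw [← e] at h2
    rw [Finset.prod_range_succ, ← hG]
    convert h2 using 2 <;> ring_nf

theorem map_polya_sum (H : IsBoundaryQuotient k z σ π η) {μ : R}
    (hμ : ∀ n, FixedBelow σ n μ) {D : R} (hD : FixedBelow σ k D) :
    π (binomSum k (fun m l => risingFact η m * risingFact μ l *
        ((∏ i ∈ Finset.range m, (z i ^ 2 - μ ^ 2)) *
          ∏ i ∈ Finset.range l, (z (m + i) ^ 2 - μ * z (m + i)))) * D) =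
      π (risingFact (η + μ) k * (∏ i ∈ Finset.range k, z i ^ 2) * D) := by
  have hrf : ∀ (a : R), (∀ n, FixedBelow σ n a) → ∀ m n, FixedBelow σ n (risingFact a m) :=
    fun a ha m n => FixedBelow.prod fun i _ => (ha n).add (fixedBelow_natCast n i)
  have h_zero : ∀ n, FixedBelow σ n (0 : R) := fun _ _ _ => map_zero _
  have hη := H.fixedBelow_eta
  have hημ : ∀ n, FixedBelow σ n (η + μ) := fun n => (hη n).add (hμ n)
  have h_negμ : ∀ n, FixedBelow σ n (-μ) := fun n => (hμ n).neg
  have h_negμ2 : ∀ n, FixedBelow σ n (-μ ^ 2) := fun n => ((hμ n).pow 2).neg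
  have h_target := H.map_evenProd_mul_word (β := 0) (c := 0) h_zero h_zero (j := 0) (p := 0)
    (l := k) (by omega) (h := risingFact (η + μ) k * D)
    (((hrf _ hημ k _).mul hD).mono (by omega))
  have h_word : ∀ m l, m + l = k → ∀ C : R, FixedBelow σ k C →
      π ((∏ i ∈ Finset.range m, (z i ^ 2 - μ ^ 2)) *
          (∏ i ∈ Finset.range l, (z (m + i) ^ 2 - μ * z (m + i))) * C) =
        π (binomSum m (fun p j => binomSum l (fun q j' =>
          risingFact (η - μ) p * risingFact (η + μ) (p + q) * risingFact (η + p) q *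
            evenProd z η (j + j'))) * C) := by
    intro m l hml C hC
    have h1 := H.map_evenProd_mul_word (β := 0) (c := -μ ^ 2) h_zero h_negμ2 (j := 0) (p := 0)
      (l := m) (by omega)
      (h := (∏ i ∈ Finset.range l, (z (m + i) ^ 2 - μ * z (m + i))) * C)
      (FixedBelow.mul (FixedBelow.prod fun i hi => by
        have := Finset.mem_range.1 hi
        have hz := H.fixedBelow_var (n := 0 + 0 + m) (j := m + i) (by omega) (by omega)
        exact (hz.pow 2).sub ((hμ _).mul hz)) (hC.mono (by omega)))
    have e1 : ∀ p, ∏ i ∈ Finset.range p,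
        ((η + (0 + i : ℕ)) ^ 2 - 0 * (η + (0 + i : ℕ)) + -μ ^ 2) =
          risingFact (η - μ) p * risingFact (η + μ) p := fun p => by
      rw [risingFact, risingFact, ← Finset.prod_mul_distrib]
      refine Finset.prod_congr rfl fun i _ => ?_
      push_cast
      ring
    simp only [e1] at h1
    simp only [evenProd, Finset.range_zero, Finset.prod_empty, one_mul, zero_add, zero_mul,
      add_zero, ← sub_eq_add_neg, ← mul_assoc] at h1
    rw [h1]
    unfold binomSum
    rw [Finset.sum_mul, Finset.sum_mul, Finset.sum_mul, map_sum, map_sum]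
    refine Finset.sum_congr rfl fun ij hij => ?_
    obtain ⟨p, j⟩ := ij
    rw [Finset.HasAntidiagonal.mem_antidiagonal] at hij
    dsimp only at hij ⊢
    have h2 := H.map_evenProd_mul_word (β := -μ) (c := 0) h_negμ h_zero (j := j) (p := p)
      (l := l) (by omega)
      (h := m.choose p * (risingFact (η - μ) p * risingFact (η + μ) p) * C)
      (((fixedBelow_natCast _ _).mul
        ((hrf _ (fun n => (hη n).sub (hμ n)) _ _).mul (hrf _ hημ _ _))).mul (hC.mono (by omega)))
    have e2 : ∀ q, ∏ i ∈ Finset.range q,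
        ((η + (p + i : ℕ)) ^ 2 - -μ * (η + (p + i : ℕ)) + 0) =
          risingFact (η + p) q * risingFact (η + μ + p) q := fun p => by
      rw [risingFact, risingFact, ← Finset.prod_mul_distrib]
      refine Finset.prod_congr rfl fun i _ => ?_
      push_cast
      ring
    simp only [e2] at h2
    have e3 : j + p = m := by omega
    rw [e3] at h2
    convert h2 using 2
    · simp only [evenProd, add_zero, sub_eq_add_neg, neg_mul]
      ring
    · unfold binomSum
      simp only [risingFact_add, evenProd]
      simp only [Finset.sum_mul, Finset.mul_sum]
      refine Finset.sum_congr rfl fun _ _ => ?_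
      ring
  have h_sum : π (binomSum k (fun m l => risingFact η m * risingFact μ l *
        ((∏ i ∈ Finset.range m, (z i ^ 2 - μ ^ 2)) *
          ∏ i ∈ Finset.range l, (z (m + i) ^ 2 - μ * z (m + i)))) * D) =
      π (binomSum k (fun m l => binomSum m (fun p j => binomSum l (fun q j' =>
          risingFact η (p + j) * risingFact μ (q + j') *
          (risingFact (η - μ) p * risingFact (η + μ) (p + q) * risingFact (η + p) q *
            evenProd z η (j + j'))))) * D) := by
    rw [binomSum, Finset.sum_mul, map_sum]
    conv_rhs => rw [binomSum, Finset.sum_mul, map_sum]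
    refine Finset.sum_congr rfl fun ij hij => ?_
    obtain ⟨m, l⟩ := ij
    rw [Finset.HasAntidiagonal.mem_antidiagonal] at hij
    dsimp only at hij ⊢
    have h3 := h_word m l hij (k.choose m * (risingFact η m * risingFact μ l) * D)
      (((fixedBelow_natCast _ _).mul ((hrf _ hη _ _).mul (hrf _ hμ _ _))).mul hD)
    have e4 : binomSum m (fun p j => binomSum l (fun q j' =>
          risingFact η (p + j) * risingFact μ (q + j') *
          (risingFact (η - μ) p * risingFact (η + μ) (p + q) * risingFact (η + p) q *
            evenProd z η (j + j')))) = (risingFact η m * risingFact μ l) *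
          binomSum m (fun p j => binomSum l (fun q j' =>
          risingFact (η - μ) p * risingFact (η + μ) (p + q) * risingFact (η + p) q *
            evenProd z η (j + j'))) := by
      rw [← binomSum_mul_left]
      refine binomSum_congr fun p j hpj => ?_
      rw [← binomSum_mul_left]
      refine binomSum_congr fun q j' hqj => ?_
      rw [hpj, hqj]
    rw [e4]
    convert h3 using 2 <;> ring
  have h_eval : binomSum k (fun m l => binomSum m (fun p j => binomSum l (fun q j' =>
          risingFact η (p + j) * risingFact μ (q + j') *
          (risingFact (η - μ) p * risingFact (η + μ) (p + q) * risingFact (η + p) q *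
            evenProd z η (j + j'))))) =
      risingFact (η + μ) k *
        binomSum k (fun r s => risingFact η r ^ 2 * evenProd z η s) := by
    rw [binomSum_exchange, ← binomSum_mul_left]
    refine binomSum_congr fun r s hrs => ?_
    have e5 : ∀ p q, p + q = r → binomSum s (fun j j' =>
        risingFact η (p + j) * risingFact μ (q + j') *
          (risingFact (η - μ) p * risingFact (η + μ) (p + q) * risingFact (η + p) q *
            evenProd z η (j + j'))) =
        (risingFact η r * risingFact (η + μ) k * evenProd z η s) *
          (risingFact (η - μ) p * risingFact μ q) := by
      intro p q hpq
      have e6 := binomSum_risingFact (η + p) (μ + q) s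
      rw [← hrs, risingFact_add _ r s, ← hpq, risingFact_add η p q]
      have e7 : η + μ + ((p + q : ℕ) : R) = (η + p) + (μ + q) := by push_cast; ring
      rw [e7, ← e6]
      trans (risingFact η p * risingFact (η + p) q * risingFact (η + μ) (p + q) *
        evenProd z η s * (risingFact (η - μ) p * risingFact μ q)) *
          binomSum s (fun j j' => risingFact (η + p) j * risingFact (μ + q) j')
      · rw [← binomSum_mul_left]
        refine binomSum_congr fun j j' hj => ?_
        rw [hj, risingFact_add η, risingFact_add μ]
        ring
      · ring
    rw [binomSum_congr e5, binomSum_mul_left, binomSum_risingFact, sub_add_cancel]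
    ring
  rw [h_sum, h_eval]
  have e8 : ∀ r, ∏ i ∈ Finset.range r, ((η + (0 + i : ℕ)) ^ 2 - 0 * (η + (0 + i : ℕ)) + 0) =
      risingFact η r ^ 2 := fun r => by
    simp [risingFact, Finset.prod_pow]
  simp only [e8] at h_target
  simp only [zero_add, zero_mul, add_zero] at h_target
  convert h_target.symm using 2
  · ring
  · simp only [evenProd, Finset.range_zero, Finset.prod_empty]
    ring

end IsBoundaryQuotient

/-- The polynomials `(z₁ + η) F₁ + ∑ (z_{i-1} - z_i - 1) F_i` with the required symmetries. -/
def boundarySubgroup (k : ℕ) [NeZero k] (η : ℂ) : AddSubgroup (MvPolynomial (Fin k) ℂ) where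
  carrier := {P | ∃ F : Fin k → MvPolynomial (Fin k) ℂ,
    (aeval (fun j : Fin k => if j = 0 then -(X 0) else X j) (F 0) = F 0) ∧
    (∀ i : Fin k, i ≠ 0 → rename (Equiv.swap (i - 1) i) (F i) = F i) ∧
    P = (X 0 + C η) * F 0 +
      ∑ i ∈ Finset.univ.filter (fun i : Fin k => i ≠ 0), (X (i - 1) - X i - 1) * F i}
  zero_mem' := ⟨0, by simp⟩
  add_mem' := by
    rintro _ _ ⟨F, hF0, hF, rfl⟩ ⟨G, hG0, hG, rfl⟩
    refine ⟨F + G, by simp only [Pi.add_apply, map_add, hF0, hG0],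
      fun i hi => by simp only [Pi.add_apply, map_add, hF i hi, hG i hi], ?_⟩
    simp only [Pi.add_apply, mul_add, Finset.sum_add_distrib]
    ring
  neg_mem' := by
    rintro _ ⟨F, hF0, hF, rfl⟩
    refine ⟨-F, by simp only [Pi.neg_apply, map_neg, hF0],
      fun i hi => by simp only [Pi.neg_apply, map_neg, hF i hi], ?_⟩
    simp only [Pi.neg_apply, mul_neg, Finset.sum_neg_distrib]
    ring

/-- The variable `X i`, or `0` when `i` is out of range. -/
noncomputable def natVar (k : ℕ) (i : ℕ) : MvPolynomial (Fin k) ℂ :=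
  if h : i < k then X ⟨i, h⟩ else 0

/-- The sign change of the first variable (`i = 0`) and the adjacent transpositions (`i > 0`). -/
noncomputable def natReflection (k : ℕ) [NeZero k] (i : ℕ) :
    MvPolynomial (Fin k) ℂ →ₐ[ℂ] MvPolynomial (Fin k) ℂ :=
  if i = 0 then aeval (fun j : Fin k => if j = 0 then -(X 0) else X j)
  else if h : i < k then rename (Equiv.swap ((⟨i, h⟩ : Fin k) - 1) ⟨i, h⟩)
  else AlgHom.id ℂ _

theorem Fin.mk_succ_sub_one {k i : ℕ} [NeZero k] (h : i + 1 < k) :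
    (⟨i + 1, h⟩ : Fin k) - 1 = ⟨i, by omega⟩ := by
  rw [sub_eq_iff_eq_add]
  ext
  have h1 : 1 % k = 1 := Nat.mod_eq_of_lt (by omega)
  simp [Fin.val_add, h1, Nat.mod_eq_of_lt h]

theorem natReflection_succ {k i : ℕ} [NeZero k] (h : i + 1 < k) :
    natReflection k (i + 1) = rename (Equiv.swap ⟨i, by omega⟩ ⟨i + 1, h⟩) := by
  simp [natReflection, h, Fin.mk_succ_sub_one]

theorem isBoundaryQuotient_boundarySubgroup (k : ℕ) [NeZero k] (η : ℂ) :
    IsBoundaryQuotient k (natVar k) (fun i => (natReflection k i : _ →+* _))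
      (QuotientAddGroup.mk' (boundarySubgroup k η)) (C η) where
  map_eta i := (natReflection k i).commutes η
  map_flip := by
    have : (⟨0, Nat.pos_of_neZero k⟩ : Fin k) = 0 := rfl
    simp [natReflection, natVar, Nat.pos_of_neZero k, this]
  map_left i hi := by
    simp [natReflection_succ hi, natVar, hi, show i < k by omega]
  map_right i hi := by
    simp [natReflection_succ hi, natVar, hi, show i < k by omega]
  map_other i j hi hj hji hji' := by
    obtain _ | i := i
    · have : (⟨j, hj⟩ : Fin k) ≠ 0 := fun h => hji (congr_arg Fin.val h)
      simp [natReflection, natVar, hj, this]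
    · simp only [natReflection_succ hi, natVar, hj, dite_true, RingHom.coe_coe, rename_X]
      rw [Equiv.swap_apply_of_ne_of_ne] <;> simp [Fin.ext_iff] <;> omega
  boundary g hg := by
    rw [QuotientAddGroup.mk'_apply, QuotientAddGroup.eq_zero_iff]
    refine ⟨Pi.single 0 g, by simpa [natReflection] using hg,
      fun i hi => by simp [Pi.single_eq_of_ne hi], ?_⟩
    rw [Finset.sum_eq_zero fun i hi => by
      simp [Pi.single_eq_of_ne (Finset.mem_filter.1 hi).2]]
    have : (⟨0, Nat.pos_of_neZero k⟩ : Fin k) = 0 := rfl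
    simp [natVar, Nat.pos_of_neZero k, this]
  exchange i g hi hg := by
    rw [QuotientAddGroup.mk'_apply, QuotientAddGroup.eq_zero_iff]
    have hi0 : (⟨i + 1, hi⟩ : Fin k) ≠ 0 := fun h => by
      simpa using congr_arg Fin.val h
    refine ⟨Pi.single ⟨i + 1, hi⟩ g, by simp, fun j hj => ?_, ?_⟩
    · by_cases h : j = ⟨i + 1, hi⟩
      · subst h
        rw [Fin.mk_succ_sub_one, Pi.single_eq_same]
        simpa [natReflection_succ hi] using hg
      · simp [Pi.single_eq_of_ne h]
    · rw [Finset.sum_eq_single_of_mem ⟨i + 1, hi⟩ (by simp [hi0])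
        fun j _ hj => by simp [Pi.single_eq_of_ne hj]]
      simp [Fin.mk_succ_sub_one, natVar, hi, show i < k by omega]

theorem ofReal_eval_ascPochhammer (x : ℝ) (n : ℕ) :
    (((ascPochhammer ℝ n).eval x : ℝ) : ℂ) = risingFact (x : ℂ) n := by
  induction n with
  | zero => simp [risingFact]
  | succ n ih =>
    rw [ascPochhammer_succ_eval, risingFact_succ, ← ih]
    push_cast
    ring

theorem C_risingFact {ι : Type*} (x : ℂ) (n : ℕ) :
    (C (risingFact x n) : MvPolynomial ι ℂ) = risingFact (C x) n := by
  simp [risingFact, map_prod]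

theorem prod_natVar (k : ℕ) (f : ℕ → MvPolynomial (Fin k) ℂ → MvPolynomial (Fin k) ℂ) :
    ∏ i : Fin k, f i (X i) = ∏ i ∈ Finset.range k, f i (natVar k i) := by
  rw [Finset.prod_range]
  exact Finset.prod_congr rfl fun i _ => by simp [natVar]

theorem prod_word_eq {k m l : ℕ} (h : m + l = k) (μ : ℂ) :
    (∏ i : Fin k, (X i - C μ)) *
      ((∏ j ∈ Finset.univ.filter (fun j : Fin k => (j : ℕ) < m), (X j + C μ)) *
        (∏ j ∈ Finset.univ.filter (fun j : Fin k => m ≤ (j : ℕ)), X j)) =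
      (∏ i ∈ Finset.range m, (natVar k i ^ 2 - C μ ^ 2)) *
        ∏ i ∈ Finset.range l, (natVar k (m + i) ^ 2 - C μ * natVar k (m + i)) := by
  rw [Finset.prod_filter, Finset.prod_filter, ← Finset.prod_mul_distrib,
    ← Finset.prod_mul_distrib,
    prod_natVar k (fun i x => (x - C μ) *
      ((if i < m then x + C μ else 1) * (if m ≤ i then x else 1))), ← h, Finset.prod_range_add]
  congr 1
  · refine Finset.prod_congr rfl fun i hi => ?_
    have hi := Finset.mem_range.1 hi
    rw [if_pos hi, if_neg (by omega)]
    ring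
  · refine Finset.prod_congr rfl fun i _ => ?_
    rw [if_neg (by omega), if_pos (by omega)]
    ring

theorem Ppoly_eq_binomSum (k : ℕ) (μ η : ℝ) :
    Ppoly k μ η = (∏ i ∈ Finset.range k, natVar k i ^ 2) -
      binomSum k (fun m l => risingFact (C (η : ℂ)) m * risingFact (C (μ : ℂ)) l *
        ((∏ i ∈ Finset.range m, (natVar k i ^ 2 - C (μ : ℂ) ^ 2)) *
          ∏ i ∈ Finset.range l, (natVar k (m + i) ^ 2 - C (μ : ℂ) * natVar k (m + i)))) *
        C (risingFact ((η : ℂ) + μ) k)⁻¹ := by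
  rw [Ppoly, prod_natVar k (fun _ x => x ^ 2)]
  congr 1
  rw [binomSum, ← Finset.Nat.sum_antidiagonal_swap, Finset.Nat.sum_antidiagonal_eq_sum_range_succ_mk,
    Finset.mul_sum, Finset.sum_mul]
  refine Finset.sum_congr rfl fun i hi => ?_
  have hik : i ≤ k := by have := Finset.mem_range.1 hi; omega
  dsimp only [Prod.swap]
  rw [← prod_word_eq (by omega) (μ : ℂ)]
  simp only [ofReal_eval_ascPochhammer, Complex.ofReal_add, div_eq_mul_inv, map_mul, map_natCast,
    C_risingFact, Nat.choose_symm hik]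
  ring

/-- Proposition 2.4 of the paper: the polynomial `P_k` admits a decomposition
`P_k = (z₁+η)F₁ + ∑_{i=2}^k (z_{i−1}−z_i−1)F_i` where `F₁` is invariant under
`z₁ ↦ −z₁` and each `F_i` is invariant under exchanging `z_{i−1}` and `z_i`. -/
theorem Ppoly_boundary_decomposition (k : ℕ) [NeZero k] (μ η : ℝ) (hμ : 0 < μ) (hη : 0 < η) :
    ∃ F : Fin k → MvPolynomial (Fin k) ℂ,
      (aeval (fun j : Fin k => if j = 0 then -(X 0) else X j) (F 0) = F 0) ∧
      (∀ i : Fin k, i ≠ 0 → rename (Equiv.swap (i - 1) i) (F i) = F i) ∧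
      Ppoly k μ η =
        (X 0 + C (η : ℂ)) * F 0 +
          ∑ i ∈ Finset.univ.filter (fun i : Fin k => i ≠ 0),
            (X (i - 1) - X i - 1) * F i := by
  have hpos : (ascPochhammer ℝ k).eval (η + μ) ≠ 0 := (ascPochhammer_pos k _ (by positivity)).ne'
  have hne : risingFact ((η : ℂ) + μ) k ≠ 0 := by
    rw [← Complex.ofReal_add, ← ofReal_eval_ascPochhammer]
    exact_mod_cast hpos
  have h := (isBoundaryQuotient_boundarySubgroup k (η : ℂ)).map_polya_sum (μ := C (μ : ℂ))
    (fun n i _ => (natReflection k i).commutes _) (D := C (risingFact ((η : ℂ) + μ) k)⁻¹)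
    (fun i _ => (natReflection k i).commutes _)
  rw [← C_add, ← C_risingFact, mul_right_comm, ← C_mul, mul_inv_cancel₀ hne, C_1, one_mul,
    eq_comm, ← sub_eq_zero, ← map_sub, ← Ppoly_eq_binomSum, QuotientAddGroup.mk'_apply,
    QuotientAddGroup.eq_zero_iff] at h
  exact h
end

section
/- For every integer k ≥ 1 and every real η > 0, BD_k = SH_k. -/
open MvPolynomial

/-- The set of monomials `z₁^{m₁}⋯z_k^{m_k}` with all `m_j ∈ {0,1,2}`;
its span is the space `R_k = ℂ[z₁,…,z_k]_{≤2,…,2}`. -/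
def Rmonomials (k : ℕ) : Set (MvPolynomial (Fin k) ℂ) :=
  { m | ∃ e : Fin k →₀ ℕ, (∀ j, e j ≤ 2) ∧ m = monomial e 1 }

/-- The space `R_k = ℂ[z₁,…,z_k]_{≤2,…,2}`. -/
noncomputable def Rspace (k : ℕ) : Submodule ℂ (MvPolynomial (Fin k) ℂ) :=
  Submodule.span ℂ (Rmonomials k)

/-- The set `BD_k` of polynomials of `R_k` admitting a boundary decomposition
`p = (z₁+η)F₁ + ∑_{i=2}^k (z_{i−1}−z_i−1)F_i` with `F₁` invariant under `z₁ ↦ −z₁`,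
`(z₁+η)F₁ ∈ R_k`, each `F_i` (for `i ≥ 2`) invariant under exchanging `z_{i−1}, z_i`,
and `(z_{i−1}−z_i−1)F_i ∈ R_k`. -/
def BDset (k : ℕ) [NeZero k] (η : ℝ) : Set (MvPolynomial (Fin k) ℂ) :=
  { p | p ∈ Rspace k ∧
      ∃ F : Fin k → MvPolynomial (Fin k) ℂ,
        (aeval (fun j : Fin k => if j = 0 then -(X 0) else X j) (F 0) = F 0) ∧
        ((X 0 + C (η : ℂ)) * F 0 ∈ Rspace k) ∧
        (∀ i : Fin k, i ≠ 0 →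
          rename (Equiv.swap (i - 1) i) (F i) = F i ∧
            (X (i - 1) - X i - 1) * F i ∈ Rspace k) ∧
        p = (X 0 + C (η : ℂ)) * F 0 +
              ∑ i ∈ Finset.univ.filter (fun i : Fin k => i ≠ 0),
                (X (i - 1) - X i - 1) * F i }

/-- The linear map `L_{r,k}`: sum, over subsets `S` of `{1,…,k}` of size `k−r`, of the
substitution of `p` at the tuple whose coordinates in `S` (in increasing order) are
`−η, −η−1, …, −η−(k−r−1)` and whose remaining coordinates (in increasing order) are the
variables `x₁,…,x_r` (indexed here by `0,…,r−1` in `MvPolynomial ℕ ℂ`). -/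
noncomputable def Lmap (k : ℕ) (η : ℝ) (r : ℕ) (p : MvPolynomial (Fin k) ℂ) :
    MvPolynomial ℕ ℂ :=
  ∑ S ∈ Finset.powersetCard (k - r) (Finset.univ : Finset (Fin k)),
    aeval (fun j : Fin k =>
      if j ∈ S then C (-(η : ℂ) - ((S.filter (fun i => i < j)).card : ℂ))
      else X (((Finset.univ \ S).filter (fun i => i < j)).card)) p

/-- The set `SH_k`: polynomials `p ∈ R_k` such that for all `0 ≤ r ≤ k` the coefficient
of `x₁²⋯x_r²` in `L_{r,k}(p)` vanishes. -/
def SHset (k : ℕ) (η : ℝ) : Set (MvPolynomial (Fin k) ℂ) :=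
  { p | p ∈ Rspace k ∧
      ∀ r ≤ k, coeff (∑ i ∈ Finset.range r, Finsupp.single i 2) (Lmap k η r p) = 0 }

/-- The set `L_k^i` of monomials `z₁^{m₁}⋯z_k^{m_k}` with all `m_j ∈ {0,1,2}` and
exponent of `z_k` equal to `i`. -/
def Lset (k : ℕ) (i : ℕ) : Set (MvPolynomial (Fin k) ℂ) :=
  { m | ∃ e : Fin k →₀ ℕ, (∀ j, e j ≤ 2) ∧ (∀ j : Fin k, (j : ℕ) = k - 1 → e j = i) ∧
      m = monomial e 1 }

/-- The set `W_k` consisting of the monomial `z₁²⋯z_k²` together with, for each `j`, the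
monomial with exponent `2` in every variable except exponent `1` in `z_j`. -/
def Wset (k : ℕ) : Set (MvPolynomial (Fin k) ℂ) :=
  { m | m = monomial (Finsupp.equivFunOnFinite.symm fun _ : Fin k => 2) 1 ∨
      ∃ j : Fin k,
        m = monomial (Finsupp.equivFunOnFinite.symm fun i : Fin k => if i = j then 1 else 2) 1 }


/-- The contribution of the set `S` to the value on `z^e` of the functional `shFunctional`. -/
noncomputable def subsetWeight {k : ℕ} (η : ℂ) (S : Finset (Fin k)) (e : Fin k →₀ ℕ) : ℂ :=
  ∏ j, if j ∈ S then (-η - ((S.filter (fun i => i < j)).card : ℂ)) ^ e j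
    else if e j = 2 then 1 else 0

theorem card_filter_lt_injOn {k : ℕ} (T : Finset (Fin k)) :
    Set.InjOn (fun j => (T.filter (fun i => i < j)).card) (T : Set (Fin k)) := by
  have key : ∀ a ∈ T, ∀ b ∈ T, a < b →
      (T.filter (fun i => i < a)).card < (T.filter (fun i => i < b)).card := by
    intro a ha b _ hab
    apply Finset.card_lt_card
    refine (Finset.ssubset_iff_of_subset ?_).2 ⟨a, by simp [ha, hab], by simp⟩
    intro i
    simp only [Finset.mem_filter]
    exact fun h => ⟨h.1, h.2.trans hab⟩
  intro a ha b hb h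
  rcases lt_trichotomy a b with hab | hab | hab
  · exact absurd h (key a ha b hb hab).ne
  · exact hab
  · exact absurd h (key b hb a ha hab).ne'

theorem image_card_filter_lt {k : ℕ} (T : Finset (Fin k)) :
    T.image (fun j => (T.filter (fun i => i < j)).card) = Finset.range T.card := by
  apply Finset.eq_of_subset_of_card_le
  · intro n
    simp only [Finset.mem_image, Finset.mem_range]
    rintro ⟨j, hj, rfl⟩
    apply Finset.card_lt_card
    exact (Finset.ssubset_iff_of_subset (Finset.filter_subset _ _)).2 ⟨j, hj, by simp⟩
  · rw [Finset.card_image_of_injOn (card_filter_lt_injOn T), Finset.card_range]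

theorem coeff_aeval_monomial {k r : ℕ} (hr : r ≤ k) (η : ℂ) (S : Finset (Fin k))
    (hS : S.card = k - r) (e : Fin k →₀ ℕ) :
    coeff (∑ i ∈ Finset.range r, Finsupp.single i 2)
      (aeval (fun j : Fin k =>
        if j ∈ S then (C (-η - ((S.filter (fun i => i < j)).card : ℂ)) : MvPolynomial ℕ ℂ)
        else X (((Finset.univ \ S).filter (fun i => i < j)).card)) (monomial e (1 : ℂ))) =
      subsetWeight η S e := by
  set T := Finset.univ \ S with hT
  have hTS : ∀ j, j ∈ T ↔ j ∉ S := by simp [hT]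
  have hTc : T.card = r := by
    rw [hT, ← Finset.compl_eq_univ_sdiff, Finset.card_compl, hS, Fintype.card_fin]; omega
  set idx : Fin k → ℕ := fun j => (T.filter (fun i => i < j)).card with hidx
  have hinj := card_filter_lt_injOn T
  have hsum : ∑ i ∈ Finset.range r, Finsupp.single i 2 = ∑ j ∈ T, Finsupp.single (idx j) 2 := by
    rw [← hTc, ← image_card_filter_lt T, Finset.sum_image hinj]
  have heval : aeval (fun j : Fin k =>
        if j ∈ S then (C (-η - ((S.filter (fun i => i < j)).card : ℂ)) : MvPolynomial ℕ ℂ)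
        else X (idx j)) (monomial e (1 : ℂ)) =
      monomial (∑ j ∈ T, Finsupp.single (idx j) (e j))
        (∏ j ∈ S, (-η - ((S.filter (fun i => i < j)).card : ℂ)) ^ e j) := by
    rw [aeval_monomial, map_one, one_mul, Finsupp.prod_fintype _ _ (by simp),
      ← Finset.prod_sdiff (Finset.subset_univ S), ← hT, ← mul_one (∏ j ∈ S, (-η - _) ^ e j),
      ← C_mul_monomial, monomial_sum_one, mul_comm]
    congr 1
    · rw [map_prod]
      exact Finset.prod_congr rfl fun j hj => by simp [hj]
    · refine Finset.prod_congr rfl fun j hj => ?_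
      rw [if_neg ((hTS j).1 hj), X_pow_eq_monomial]
  have hiff : (∑ j ∈ T, Finsupp.single (idx j) (e j) = ∑ j ∈ T, Finsupp.single (idx j) 2) ↔
      ∀ j ∈ T, e j = 2 := by
    constructor
    · intro h j hj
      have h' := DFunLike.congr_fun h (idx j)
      have hs : ∀ g : Fin k → ℕ, (∑ j ∈ T, Finsupp.single (idx j) (g j)) (idx j) = g j := by
        intro g
        rw [Finsupp.finsetSum_apply, Finset.sum_eq_single_of_mem j hj, Finsupp.single_eq_same]
        intro b hb hbj
        exact Finsupp.single_eq_of_ne fun hc => hbj (hinj hb hj hc.symm)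
      rwa [hs, hs (fun _ => 2)] at h'
    · intro h
      exact Finset.sum_congr rfl fun j hj => by rw [h j hj]
  rw [heval, hsum, coeff_monomial, subsetWeight, ← Finset.prod_sdiff (Finset.subset_univ S), ← hT]
  have h1 : ∏ j ∈ S, (if j ∈ S then (-η - ((S.filter (fun i => i < j)).card : ℂ)) ^ e j
      else if e j = 2 then 1 else 0) =
      ∏ j ∈ S, (-η - ((S.filter (fun i => i < j)).card : ℂ)) ^ e j :=
    Finset.prod_congr rfl fun j hj => if_pos hj
  have h2 : ∏ j ∈ T, (if j ∈ S then (-η - ((S.filter (fun i => i < j)).card : ℂ)) ^ e j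
      else if e j = 2 then 1 else 0) = if ∀ j ∈ T, e j = 2 then 1 else 0 := by
    refine (Finset.prod_congr rfl fun j hj => if_neg ((hTS j).1 hj)).trans ?_
    rw [Finset.prod_boole]
    congr
  rw [h1, h2]
  simp only [hiff]
  split_ifs <;> simp

section
variable {M : Type*} [AddCommGroup M] [Module ℂ M]

/-- The span of the values of `f` at the words `0^s 2^t' v` with `s + t' = n` and `t' ≤ t`. -/
def sortedSpan (f : List ℕ → M) (n t : ℕ) (v : List ℕ) : Submodule ℂ M :=
  Submodule.span ℂ {m | ∃ s t', s + t' = n ∧ t' ≤ t ∧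
    m = f (List.replicate s 0 ++ (List.replicate t' 2 ++ v))}

theorem sortedSpan_mono (f : List ℕ → M) (n : ℕ) {t t' : ℕ} (h : t ≤ t') (v : List ℕ) :
    sortedSpan f n t v ≤ sortedSpan f n t' v :=
  Submodule.span_mono fun _ ⟨s, t'', hs, ht, hm⟩ => ⟨s, t'', hs, ht.trans h, hm⟩

theorem replicate_append_cons {α : Type*} (n : ℕ) (a : α) (v : List α) :
    List.replicate n a ++ a :: v = List.replicate (n + 1) a ++ v := by
  rw [List.replicate_succ', List.append_assoc, List.singleton_append]

theorem sortedSpan_two_cons_le (f : List ℕ → M) (n t : ℕ) (v : List ℕ) :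
    sortedSpan f n t (2 :: v) ≤ sortedSpan f (n + 1) (t + 1) v := by
  refine Submodule.span_mono ?_
  rintro _ ⟨s, t', hs, ht, rfl⟩
  exact ⟨s, t' + 1, by omega, by omega, by rw [replicate_append_cons]⟩

/-- A map on words of length `k` satisfying the homogeneous relations
`e₁ e₀ = e₀ e₁ + e₀²`, `e₂ e₀ = e₀ e₂ + e₁ e₀ + e₀ e₁`, `e₂ e₁ = e₁ e₂ + e₁²`,
and `e₁ = -η e₀` in the first position. -/
structure WordRelations (k : ℕ) (η : ℂ) (f : List ℕ → M) : Prop where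
  head : ∀ v : List ℕ, v.length + 1 = k → f (1 :: v) = (-η) • f (0 :: v)
  one_zero : ∀ u v : List ℕ, u.length + v.length + 2 = k →
    f (u ++ 1 :: 0 :: v) = f (u ++ 0 :: 1 :: v) + f (u ++ 0 :: 0 :: v)
  two_zero : ∀ u v : List ℕ, u.length + v.length + 2 = k →
    f (u ++ 2 :: 0 :: v) = f (u ++ 0 :: 2 :: v) + f (u ++ 1 :: 0 :: v) + f (u ++ 0 :: 1 :: v)
  two_one : ∀ u v : List ℕ, u.length + v.length + 2 = k →
    f (u ++ 2 :: 1 :: v) = f (u ++ 1 :: 2 :: v) + f (u ++ 1 :: 1 :: v)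

namespace WordRelations
variable {k : ℕ} {η : ℂ} {f : List ℕ → M}

theorem replicate_zero_one (hf : WordRelations k η f) (s : ℕ) (v : List ℕ)
    (hv : s + v.length + 1 = k) :
    f (List.replicate s 0 ++ 1 :: v) = (-η - s) • f (List.replicate (s + 1) 0 ++ v) := by
  induction s generalizing v with
  | zero => simpa using hf.head v (by omega)
  | succ s ih =>
    have h1 := ih (0 :: v) (by simp; omega)
    have h2 := hf.one_zero (List.replicate s 0) v (by simp; omega)
    rw [h1, replicate_append_cons, replicate_append_cons, replicate_append_cons] at h2
    have h3 := eq_sub_of_add_eq h2.symm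
    rw [h3, ← replicate_append_cons (s + 1) 0 v]
    push_cast
    module

theorem sorted_append_mem (hf : WordRelations k η f) (t : ℕ) :
    ∀ (a s : ℕ) (v : List ℕ), a ≤ 1 → s + t + v.length + 1 = k →
      f (List.replicate s 0 ++ (List.replicate t 2 ++ a :: v)) ∈
        sortedSpan f (s + t + 1) t v := by
  induction t using Nat.strong_induction_on with
  | _ t ih =>
  have hcons : ∀ t' < t, ∀ (a n : ℕ) (v : List ℕ), a ≤ 1 → n + v.length + 1 = k →
      sortedSpan f n t' (a :: v) ≤ sortedSpan f (n + 1) t' v := by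
    intro t' ht' a n v ha hn
    refine Submodule.span_le.2 ?_
    rintro _ ⟨s, t'', hs, ht, rfl⟩
    subst hs
    exact sortedSpan_mono f _ ht v (ih t'' (by omega) a s v ha (by omega))
  intro a s v ha hk
  cases t with
  | zero =>
    have hmem : f (List.replicate (s + 1) 0 ++ v) ∈ sortedSpan f (s + 0 + 1) 0 v :=
      Submodule.subset_span ⟨s + 1, 0, by omega, le_rfl, by simp⟩
    interval_cases a
    · simpa [replicate_append_cons] using hmem
    · rw [List.replicate_zero, List.nil_append, hf.replicate_zero_one s v (by omega)]
      exact Submodule.smul_mem _ _ hmem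
  | succ t =>
    have hmem : ∀ a b, a ≤ 1 → b ≤ 1 →
        f (List.replicate s 0 ++ (List.replicate t 2 ++ a :: b :: v)) ∈
          sortedSpan f (s + (t + 1) + 1) (t + 1) v := fun a b ha hb =>
      sortedSpan_mono f _ t.le_succ v (hcons t t.lt_succ_self b _ v hb (by omega)
        (ih t t.lt_succ_self a s (b :: v) ha (by simp; omega)))
    have hmem2 : ∀ a, a ≤ 1 →
        f (List.replicate s 0 ++ (List.replicate t 2 ++ a :: 2 :: v)) ∈
          sortedSpan f (s + (t + 1) + 1) (t + 1) v := fun a ha =>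
      sortedSpan_two_cons_le f _ _ v (ih t t.lt_succ_self a s (2 :: v) ha (by simp; omega))
    have hl : (List.replicate s 0 ++ List.replicate t 2).length + v.length + 2 = k := by
      simp; omega
    rw [← replicate_append_cons]
    interval_cases a
    · have h := hf.two_zero _ v hl
      simp only [List.append_assoc] at h
      rw [h]
      exact add_mem (add_mem (hmem2 0 (by omega)) (hmem 1 0 le_rfl (by omega)))
        (hmem 0 1 (by omega) le_rfl)
    · have h := hf.two_one _ v hl
      simp only [List.append_assoc] at h
      rw [h]
      exact add_mem (hmem2 1 le_rfl) (hmem 1 1 le_rfl le_rfl)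

theorem append_mem (hf : WordRelations k η f) (u : List ℕ) (hu : ∀ a ∈ u, a ≤ 2) :
    ∀ v : List ℕ, u.length + v.length = k → f (u ++ v) ∈ sortedSpan f u.length u.length v := by
  induction u using List.reverseRecOn with
  | nil => exact fun v _ => Submodule.subset_span ⟨0, 0, rfl, le_rfl, by simp⟩
  | append_singleton u a ih =>
    intro v hv
    simp only [List.length_append, List.length_singleton] at hv ⊢
    have h := ih (fun b hb => hu b (by simp [hb])) (a :: v) (by simp; omega)
    rw [List.append_assoc, List.singleton_append]
    have ha := hu a (by simp)
    rcases Nat.lt_or_ge a 2 with ha' | ha'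
    · refine (Submodule.span_le.2 ?_ : sortedSpan f u.length u.length (a :: v) ≤ _) h
      rintro _ ⟨s, t, hs, ht, rfl⟩
      rw [← hs]
      exact sortedSpan_mono f _ (by omega) v (hf.sorted_append_mem t a s v (by omega) (by omega))
    · obtain rfl : a = 2 := by omega
      exact sortedSpan_two_cons_le f _ _ v h

end WordRelations
end

theorem mem_Rspace_iff {k : ℕ} {p : MvPolynomial (Fin k) ℂ} :
    p ∈ Rspace k ↔ ∀ e ∈ p.support, ∀ j, e j ≤ 2 := by
  have h : Rspace k = restrictSupport ℂ {e : Fin k →₀ ℕ | ∀ j, e j ≤ 2} := by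
    rw [restrictSupport_eq_span, Rspace]
    congr 1
    ext m
    exact ⟨fun ⟨e, he, hm⟩ => ⟨e, he, hm.symm⟩, fun ⟨e, he, hm⟩ => ⟨e, he, hm.symm⟩⟩
  rw [h, mem_restrictSupport_iff]
  rfl

theorem monomial_mem_Rspace {k : ℕ} {e : Fin k →₀ ℕ} (he : ∀ j, e j ≤ 2) :
    monomial e (1 : ℂ) ∈ Rspace k :=
  Submodule.subset_span ⟨e, he, rfl⟩

/-- The coefficient of `x₁²⋯x_r²` in `L_{r,k}(p)`, as a linear functional of `p`. -/
noncomputable def shFunctional (k : ℕ) (η : ℝ) (r : ℕ) : MvPolynomial (Fin k) ℂ →ₗ[ℂ] ℂ :=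
  lcoeff ℂ (∑ i ∈ Finset.range r, Finsupp.single i 2) ∘ₗ
    ∑ S ∈ Finset.powersetCard (k - r) (Finset.univ : Finset (Fin k)),
      (aeval (fun j : Fin k =>
        if j ∈ S then (C (-(η : ℂ) - ((S.filter (fun i => i < j)).card : ℂ)) : MvPolynomial ℕ ℂ)
        else X (((Finset.univ \ S).filter (fun i => i < j)).card))).toLinearMap

theorem shFunctional_apply (k : ℕ) (η : ℝ) (r : ℕ) (p : MvPolynomial (Fin k) ℂ) :
    shFunctional k η r p = coeff (∑ i ∈ Finset.range r, Finsupp.single i 2) (Lmap k η r p) := by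
  simp [shFunctional, Lmap, coeff_sum]

theorem shFunctional_monomial {k r : ℕ} (hr : r ≤ k) (η : ℝ) (e : Fin k →₀ ℕ) :
    shFunctional k η r (monomial e 1) =
      ∑ S ∈ Finset.powersetCard (k - r) Finset.univ, subsetWeight (η : ℂ) S e := by
  rw [shFunctional_apply, Lmap, coeff_sum]
  exact Finset.sum_congr rfl fun S hS =>
    coeff_aeval_monomial hr _ S (Finset.mem_powersetCard.1 hS).2 e

/-- The factor of `subsetWeight` at position `j` when the exponent there is `n`. -/
noncomputable def positionWeight {k : ℕ} (η : ℂ) (S : Finset (Fin k)) (j : Fin k) (n : ℕ) : ℂ :=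
  if j ∈ S then (-η - ((S.filter (fun i => i < j)).card : ℂ)) ^ n else if n = 2 then 1 else 0

theorem subsetWeight_eq_mul {k : ℕ} (η : ℂ) (S : Finset (Fin k)) (a : Fin k) (e : Fin k →₀ ℕ) :
    subsetWeight η S e = positionWeight η S a (e a) *
      ∏ j ∈ Finset.univ.erase a, positionWeight η S j (e j) :=
  (Finset.mul_prod_erase Finset.univ (fun j => positionWeight η S j (e j))
    (Finset.mem_univ a)).symm

theorem subsetWeight_eq_mul_mul {k : ℕ} (η : ℂ) (S : Finset (Fin k)) {a b : Fin k} (hab : a ≠ b)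
    (e e' : Fin k →₀ ℕ) (he : ∀ j, j ≠ a → j ≠ b → e j = e' j) :
    subsetWeight η S e = positionWeight η S a (e a) * positionWeight η S b (e b) *
      ∏ j ∈ (Finset.univ.erase a).erase b, positionWeight η S j (e' j) := by
  rw [subsetWeight_eq_mul η S a,
    ← Finset.mul_prod_erase (Finset.univ.erase a) _ (Finset.mem_erase.2 ⟨hab.symm, Finset.mem_univ b⟩),
    mul_assoc]
  congr 2
  refine Finset.prod_congr rfl fun j hj => ?_
  simp only [Finset.mem_erase, Finset.mem_univ, and_true] at hj
  rw [he j hj.2 hj.1]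

theorem subsetWeight_add_single_zero {k : ℕ} [NeZero k] (η : ℂ) (S : Finset (Fin k))
    (e : Fin k →₀ ℕ) (he : e 0 = 0) :
    subsetWeight η S (e + Finsupp.single 0 1) + η * subsetWeight η S e = 0 := by
  have hprod : ∏ j ∈ Finset.univ.erase 0, positionWeight η S j ((e + Finsupp.single 0 1 : Fin k →₀ ℕ) j) =
      ∏ j ∈ Finset.univ.erase 0, positionWeight η S j (e j) := by
    refine Finset.prod_congr rfl fun j hj => ?_
    rw [Finsupp.add_apply, Finsupp.single_eq_of_ne (Finset.ne_of_mem_erase hj), add_zero]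
  rw [subsetWeight_eq_mul η S 0, subsetWeight_eq_mul η S 0 e, hprod, Finsupp.add_apply,
    Finsupp.single_eq_same, he]
  by_cases h : (0 : Fin k) ∈ S <;> simp [positionWeight, h]

theorem card_filter_lt_map_swap {k : ℕ} (S : Finset (Fin k)) (a b j : Fin k) :
    ((S.map (Equiv.swap a b).toEmbedding).filter (fun i => i < j)).card =
      (S.filter (fun i => Equiv.swap a b i < j)).card := by
  rw [Finset.filter_map, Finset.card_map]
  rfl

theorem mem_map_swap {k : ℕ} (S : Finset (Fin k)) (a b j : Fin k) :
    j ∈ S.map (Equiv.swap a b).toEmbedding ↔ Equiv.swap a b j ∈ S := by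
  simp [Finset.mem_map_equiv]

theorem positionWeight_map_swap {k : ℕ} (η : ℂ) (S : Finset (Fin k)) {a b : Fin k}
    (hab : (b : ℕ) = a + 1) {j : Fin k} (ha : j ≠ a) (hb : j ≠ b) (n : ℕ) :
    positionWeight η (S.map (Equiv.swap a b).toEmbedding) j n = positionWeight η S j n := by
  have h : ∀ i, Equiv.swap a b i < j ↔ i < j := by
    intro i
    rw [Equiv.swap_apply_def]
    split_ifs <;> omega
  simp only [positionWeight, mem_map_swap, card_filter_lt_map_swap, h,
    Equiv.swap_apply_of_ne_of_ne ha hb]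

/-- The factor at the adjacent positions `a, b` of the total weight of
`(z_a - z_b - 1)(z_a^x z_b^y + z_a^y z_b^x)`. -/
noncomputable def pairWeight {k : ℕ} (η : ℂ) (S : Finset (Fin k)) (a b : Fin k) (x y : ℕ) : ℂ :=
  positionWeight η S a (x + 1) * positionWeight η S b y
    - positionWeight η S a x * positionWeight η S b (y + 1)
    - positionWeight η S a x * positionWeight η S b y
    + positionWeight η S a (y + 1) * positionWeight η S b x
    - positionWeight η S a y * positionWeight η S b (x + 1)
    - positionWeight η S a y * positionWeight η S b x

theorem pairWeight_eq_zero {k : ℕ} (η : ℂ) (S : Finset (Fin k)) {a b : Fin k}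
    (hab : (b : ℕ) = a + 1) {x y : ℕ} (hx : x ≤ 1) (hy : y ≤ 1) (h : a ∈ S ↔ b ∈ S) :
    pairWeight η S a b x y = 0 := by
  by_cases ha : a ∈ S
  · have hb := h.1 ha
    have hc : (S.filter (fun i => i < b)).card = (S.filter (fun i => i < a)).card + 1 := by
      have : S.filter (fun i => i < b) = insert a (S.filter (fun i => i < a)) := by
        ext i
        simp only [Finset.mem_filter, Finset.mem_insert]
        constructor
        · rintro ⟨hi, hlt⟩
          rcases eq_or_ne i a with rfl | hne
          · exact Or.inl rfl
          · exact Or.inr ⟨hi, by omega⟩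
        · rintro (rfl | ⟨hi, hlt⟩)
          · exact ⟨ha, by omega⟩
          · exact ⟨hi, by omega⟩
      rw [this, Finset.card_insert_of_notMem (by simp)]
    simp only [pairWeight, positionWeight, ha, hb, if_true, hc]
    push_cast
    ring
  · have hb : b ∉ S := fun hb => ha (h.2 hb)
    simp only [pairWeight, positionWeight, ha, hb, if_false]
    interval_cases x <;> interval_cases y <;> simp

theorem pairWeight_add_map_swap_of_mem {k : ℕ} (η : ℂ) (S : Finset (Fin k)) {a b : Fin k}
    (hab : (b : ℕ) = a + 1) {x y : ℕ} (hx : x ≤ 1) (hy : y ≤ 1) (ha : a ∈ S) (hb : b ∉ S) :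
    pairWeight η S a b x y +
      pairWeight η (S.map (Equiv.swap a b).toEmbedding) a b x y = 0 := by
  have hc : ((S.map (Equiv.swap a b).toEmbedding).filter (fun i => i < b)).card =
      (S.filter (fun i => i < a)).card := by
    rw [card_filter_lt_map_swap]
    congr 1
    refine Finset.filter_congr fun i hi => ?_
    have hib : i ≠ b := fun h => hb (h ▸ hi)
    rw [Equiv.swap_apply_def]
    split_ifs <;> omega
  have ha' : a ∉ S.map (Equiv.swap a b).toEmbedding := by
    rwa [mem_map_swap, Equiv.swap_apply_left]
  have hb' : b ∈ S.map (Equiv.swap a b).toEmbedding := by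
    rwa [mem_map_swap, Equiv.swap_apply_right]
  simp only [pairWeight, positionWeight, ha, hb, ha', hb', if_true, if_false, hc]
  interval_cases x <;> interval_cases y <;> simp <;> ring

theorem map_swap_map_swap {k : ℕ} (S : Finset (Fin k)) (a b : Fin k) :
    (S.map (Equiv.swap a b).toEmbedding).map (Equiv.swap a b).toEmbedding = S := by
  ext j
  rw [mem_map_swap, mem_map_swap, Equiv.swap_apply_self]

theorem pairWeight_add_map_swap {k : ℕ} (η : ℂ) (S : Finset (Fin k)) {a b : Fin k}
    (hab : (b : ℕ) = a + 1) {x y : ℕ} (hx : x ≤ 1) (hy : y ≤ 1) :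
    pairWeight η S a b x y +
      pairWeight η (S.map (Equiv.swap a b).toEmbedding) a b x y = 0 := by
  have ha' : a ∈ S.map (Equiv.swap a b).toEmbedding ↔ b ∈ S := by
    rw [mem_map_swap, Equiv.swap_apply_left]
  have hb' : b ∈ S.map (Equiv.swap a b).toEmbedding ↔ a ∈ S := by
    rw [mem_map_swap, Equiv.swap_apply_right]
  by_cases h : a ∈ S ↔ b ∈ S
  · rw [pairWeight_eq_zero η S hab hx hy h,
      pairWeight_eq_zero η _ hab hx hy (by rw [ha', hb', h]), add_zero]
  · by_cases ha : a ∈ S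
    · exact pairWeight_add_map_swap_of_mem η S hab hx hy ha fun hb => h ⟨fun _ => hb, fun _ => ha⟩
    · have hb : b ∈ S := by tauto
      have h' := pairWeight_add_map_swap_of_mem η (S.map (Equiv.swap a b).toEmbedding) hab hx hy
        (ha'.2 hb) (fun hc => ha (hb'.1 hc))
      rwa [map_swap_map_swap, add_comm] at h'

theorem shFunctional_bulk_monomial {k r : ℕ} (hr : r ≤ k) (η : ℝ) {a b : Fin k}
    (hab : (b : ℕ) = a + 1) (e : Fin k →₀ ℕ) (ha : e a ≤ 1) (hb : e b ≤ 1) :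
    shFunctional k η r ((X a - X b - 1) *
      (monomial e 1 + rename (Equiv.swap a b) (monomial e 1))) = 0 := by
  have hne : a ≠ b := by rintro rfl; omega
  set e' : Fin k →₀ ℕ := e.mapDomain (Equiv.swap a b) with he'
  have he'app : ∀ j, e' j = e (Equiv.swap a b j) := fun j => by
    rw [he', Finsupp.mapDomain_equiv_apply, Equiv.symm_swap]
  have hX : ∀ (c : Fin k) (d : Fin k →₀ ℕ),
      (X c : MvPolynomial (Fin k) ℂ) * monomial d 1 = monomial (d + Finsupp.single c 1) 1 := by
    intro c d
    rw [X, monomial_mul, one_mul, add_comm]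
  have hexp : (X a - X b - 1) * (monomial e (1 : ℂ) + rename (Equiv.swap a b) (monomial e 1)) =
      monomial (e + Finsupp.single a 1) 1 - monomial (e + Finsupp.single b 1) 1 - monomial e 1
      + monomial (e' + Finsupp.single a 1) 1 - monomial (e' + Finsupp.single b 1) 1
      - monomial e' 1 := by
    rw [rename_monomial, ← hX, ← hX, ← hX, ← hX]
    ring
  rw [hexp]
  simp only [map_add, map_sub, shFunctional_monomial hr, ← Finset.sum_add_distrib,
    ← Finset.sum_sub_distrib]
  set rest : Finset (Fin k) → ℂ := fun S =>
    ∏ j ∈ (Finset.univ.erase a).erase b, positionWeight (η : ℂ) S j (e j) with hrest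
  have hterm : ∀ S : Finset (Fin k),
      subsetWeight (η : ℂ) S (e + Finsupp.single a 1)
      - subsetWeight (η : ℂ) S (e + Finsupp.single b 1) - subsetWeight (η : ℂ) S e
      + subsetWeight (η : ℂ) S (e' + Finsupp.single a 1)
      - subsetWeight (η : ℂ) S (e' + Finsupp.single b 1) - subsetWeight (η : ℂ) S e' =
      pairWeight (η : ℂ) S a b (e a) (e b) * rest S := by
    intro S
    have h1 : ∀ c, c = a ∨ c = b → ∀ j, j ≠ a → j ≠ b →
        (e + Finsupp.single c 1 : Fin k →₀ ℕ) j = e j := by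
      rintro c (rfl | rfl) j hja hjb <;> simp [hja, hjb]
    have h2 : ∀ j, j ≠ a → j ≠ b → e' j = e j := fun j hja hjb => by
      rw [he'app, Equiv.swap_apply_of_ne_of_ne hja hjb]
    have h3 : ∀ c, c = a ∨ c = b → ∀ j, j ≠ a → j ≠ b →
        (e' + Finsupp.single c 1 : Fin k →₀ ℕ) j = e j := by
      rintro c (rfl | rfl) j hja hjb <;> simp [hja, hjb, h2]
    rw [subsetWeight_eq_mul_mul _ S hne _ e (h1 a (Or.inl rfl)),
      subsetWeight_eq_mul_mul _ S hne _ e (h1 b (Or.inr rfl)),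
      subsetWeight_eq_mul_mul _ S hne e e (fun _ _ _ => rfl),
      subsetWeight_eq_mul_mul _ S hne _ e (h3 a (Or.inl rfl)),
      subsetWeight_eq_mul_mul _ S hne _ e (h3 b (Or.inr rfl)),
      subsetWeight_eq_mul_mul _ S hne e' e h2]
    simp only [Finsupp.add_apply, Finsupp.single_eq_same, Finsupp.single_eq_of_ne hne,
      Finsupp.single_eq_of_ne hne.symm, he'app, Equiv.swap_apply_left, Equiv.swap_apply_right,
      add_zero, pairWeight, hrest]
    ring
  have hrest_swap : ∀ S, rest (S.map (Equiv.swap a b).toEmbedding) = rest S := by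
    intro S
    refine Finset.prod_congr rfl fun j hj => ?_
    simp only [Finset.mem_erase, Finset.mem_univ, and_true] at hj
    exact positionWeight_map_swap _ S hab hj.2 hj.1 _
  simp only [hterm]
  refine Finset.sum_involution (fun S _ => S.map (Equiv.swap a b).toEmbedding) ?_ ?_ ?_ ?_
  · intro S _
    rw [hrest_swap, ← add_mul, pairWeight_add_map_swap _ S hab ha hb, zero_mul]
  · intro S _ hS hfix
    refine hS ?_
    rw [pairWeight_eq_zero _ S hab ha hb, zero_mul]
    conv_lhs => rw [← hfix, mem_map_swap, Equiv.swap_apply_left]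
  · intro S hS
    rw [Finset.mem_powersetCard] at hS ⊢
    exact ⟨Finset.subset_univ _, by rw [Finset.card_map, hS.2]⟩
  · intro S _
    exact map_swap_map_swap S a b

theorem le_one_of_mul_mem_Rspace {k : ℕ} {q F : MvPolynomial (Fin k) ℂ} {a : Fin k}
    (hq : coeff (Finsupp.single a 1) q ≠ 0) (h : q * F ∈ Rspace k) {e : Fin k →₀ ℕ}
    (he : e ∈ F.support) : e a ≤ 1 := by
  have hq0 : q ≠ 0 := by rintro rfl; simp at hq
  have hF0 : F ≠ 0 := by rintro rfl; simp at he
  have h1 : 1 ≤ degreeOf a q := by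
    simpa using monomial_le_degreeOf a (mem_support_iff.2 hq)
  have h2 : e a ≤ degreeOf a F := monomial_le_degreeOf a he
  have h3 : degreeOf a (q * F) ≤ 2 :=
    degreeOf_le_iff.2 fun m hm => mem_Rspace_iff.1 h m hm a
  rw [degreeOf_mul_eq hq0 hF0] at h3
  omega

theorem linear_apply_eq_zero_of_involution {k : ℕ}
    (φ : MvPolynomial (Fin k) ℂ →ₗ[ℂ] ℂ) (σ : MvPolynomial (Fin k) ℂ →ₗ[ℂ] MvPolynomial (Fin k) ℂ)
    (q F : MvPolynomial (Fin k) ℂ) (hF : σ F = F)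
    (h : ∀ e ∈ F.support, φ (q * (monomial e 1 + σ (monomial e 1))) = 0) : φ (q * F) = 0 := by
  set ψ : MvPolynomial (Fin k) ℂ →ₗ[ℂ] ℂ :=
    φ ∘ₗ LinearMap.mulLeft ℂ q ∘ₗ (LinearMap.id + σ) with hψ
  have h2 : ψ F = 0 := by
    rw [F.as_sum, map_sum]
    refine Finset.sum_eq_zero fun e he => ?_
    rw [← mul_one (coeff e F), ← smul_eq_mul, ← smul_monomial, map_smul]
    simp [hψ, h e he]
  have h3 : ψ F = 2 * φ (q * F) := by
    simp [hψ, hF, mul_add, two_mul]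
  rw [h3] at h2
  simpa using h2

theorem shFunctional_bulk {k r : ℕ} (hr : r ≤ k) (η : ℝ) {a b : Fin k}
    (hab : (b : ℕ) = a + 1) {F : MvPolynomial (Fin k) ℂ}
    (hF : rename (Equiv.swap a b) F = F) (h : (X a - X b - 1) * F ∈ Rspace k) :
    shFunctional k η r ((X a - X b - 1) * F) = 0 := by
  have hne : a ≠ b := by rintro rfl; omega
  refine linear_apply_eq_zero_of_involution _ (rename (Equiv.swap a b)).toLinearMap _ F hF ?_
  intro e he
  refine shFunctional_bulk_monomial hr η hab e (le_one_of_mul_mem_Rspace ?_ h he)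
    (le_one_of_mul_mem_Rspace ?_ h he) <;>
    simp [coeff_X, coeff_one, Finsupp.single_left_inj, hne, hne.symm, @eq_comm (Fin k →₀ ℕ) 0]

theorem shFunctional_boundary {k r : ℕ} [NeZero k] (hr : r ≤ k) (η : ℝ)
    {F : MvPolynomial (Fin k) ℂ}
    (hF : aeval (fun j : Fin k => if j = 0 then -(X 0) else X j) F = F)
    (h : (X 0 + C (η : ℂ)) * F ∈ Rspace k) :
    shFunctional k η r ((X 0 + C (η : ℂ)) * F) = 0 := by
  refine linear_apply_eq_zero_of_involution _
    (aeval (fun j : Fin k => if j = 0 then -(X 0) else X j)).toLinearMap _ F hF ?_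
  intro e he
  have he1 : e 0 ≤ 1 := le_one_of_mul_mem_Rspace (by simp [coeff_X, coeff_C, @eq_comm (Fin k →₀ ℕ) 0]) h he
  have hσ : aeval (fun j : Fin k => if j = 0 then -(X 0) else X j) (monomial e (1 : ℂ)) =
      (-1) ^ e 0 * monomial e (1 : ℂ) := by
    rw [monomial_eq, map_mul, Finsupp.prod_fintype _ _ (by simp), map_prod, map_one, map_one,
      ← Finset.mul_prod_erase Finset.univ _ (Finset.mem_univ 0),
      ← Finset.mul_prod_erase Finset.univ _ (Finset.mem_univ 0), one_mul, one_mul, ← mul_assoc]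
    congr 1
    · simp [← mul_pow]
    · exact Finset.prod_congr rfl fun j hj => by simp [Finset.ne_of_mem_erase hj]
  rw [AlgHom.toLinearMap_apply, hσ]
  rcases Nat.le_one_iff_eq_zero_or_eq_one.1 he1 with h0 | h1
  · have hexp : (X 0 + C (η : ℂ)) * (monomial e 1 + (-1) ^ e 0 * monomial e (1 : ℂ)) =
        (2 : ℂ) • (monomial (e + Finsupp.single 0 1) 1 + (η : ℂ) • monomial e 1) := by
      rw [h0, pow_zero, one_mul, ← two_mul, add_comm e, ← one_mul (1 : ℂ), ← monomial_mul,
        smul_eq_C_mul, smul_eq_C_mul, X, map_ofNat C 2]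
      simp only [mul_one]
      ring
    rw [hexp, map_smul, map_add, map_smul, shFunctional_monomial hr, shFunctional_monomial hr,
      Finset.smul_sum, ← Finset.sum_add_distrib, Finset.sum_eq_zero, smul_zero]
    exact fun S _ => subsetWeight_add_single_zero _ S e h0
  · simp [h1]

theorem val_eq_val_sub_one_add_one {k : ℕ} [NeZero k] {i : Fin k} (hi : i ≠ 0) :
    (i : ℕ) = ((i - 1 : Fin k) : ℕ) + 1 := by
  have := Fin.val_sub_one_of_ne_zero hi
  have h0 : (i : ℕ) ≠ 0 := fun h => hi (Fin.ext (by simpa using h))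
  omega

theorem shFunctional_eq_zero_of_mem_BDset {k r : ℕ} [NeZero k] (hr : r ≤ k) (η : ℝ)
    {p : MvPolynomial (Fin k) ℂ} (hp : p ∈ BDset k η) : shFunctional k η r p = 0 := by
  obtain ⟨-, F, h0, h0', hi, rfl⟩ := hp
  rw [map_add, map_sum, shFunctional_boundary hr η h0 h0', zero_add]
  refine Finset.sum_eq_zero fun i hi' => ?_
  have hi0 : i ≠ 0 := (Finset.mem_filter.1 hi').2
  exact shFunctional_bulk hr η (val_eq_val_sub_one_add_one hi0) (hi i hi0).1 (hi i hi0).2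

theorem getD_append_cons_cons {k : ℕ} (u v : List ℕ) (x y : ℕ) {a b : Fin k} (ha : (a : ℕ) = u.length)
    (hb : (b : ℕ) = u.length + 1) (j : Fin k) :
    (u ++ x :: y :: v).getD j 0 = (u ++ 0 :: 0 :: v).getD j 0 +
      (Finsupp.single a x + Finsupp.single b y : Fin k →₀ ℕ) j := by
  have hne : a ≠ b := by rintro rfl; omega
  rw [Finsupp.add_apply]
  rcases eq_or_ne j a with rfl | hja
  · rw [Finsupp.single_eq_same, Finsupp.single_eq_of_ne hne, ha,
      List.getD_append_right _ _ _ _ le_rfl, List.getD_append_right _ _ _ _ le_rfl]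
    simp
  rcases eq_or_ne j b with rfl | hjb
  · rw [Finsupp.single_eq_same, Finsupp.single_eq_of_ne hja, hb,
      List.getD_append_right _ _ _ _ (by omega), List.getD_append_right _ _ _ _ (by omega)]
    simp
  rw [Finsupp.single_eq_of_ne hja, Finsupp.single_eq_of_ne hjb]
  rcases Nat.lt_or_ge j u.length with hlt | hge
  · rw [List.getD_append _ _ _ _ hlt, List.getD_append _ _ _ _ hlt]
    rfl
  · rw [List.getD_append_right _ _ _ _ hge, List.getD_append_right _ _ _ _ hge]
    obtain ⟨m, hm⟩ : ∃ m, (j : ℕ) - u.length = m + 2 :=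
      ⟨(j : ℕ) - u.length - 2, by omega⟩
    simp [hm]

/-- The monomial `∏ z_j^{w_j}` of a word `w` of exponents. -/
noncomputable def wordMonomial (k : ℕ) (w : List ℕ) : MvPolynomial (Fin k) ℂ :=
  monomial (Finsupp.equivFunOnFinite.symm fun j : Fin k => w.getD j 0) 1

theorem wordMonomial_append {k : ℕ} (u v : List ℕ) (x y : ℕ) {a b : Fin k}
    (ha : (a : ℕ) = u.length) (hb : (b : ℕ) = u.length + 1) :
    wordMonomial k (u ++ x :: y :: v) =
      X a ^ x * X b ^ y * wordMonomial k (u ++ 0 :: 0 :: v) := by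
  rw [wordMonomial, wordMonomial, X_pow_eq_monomial, X_pow_eq_monomial, monomial_mul,
    monomial_mul]
  refine congrArg₂ (fun d c => monomial d c) (Finsupp.ext fun j => ?_) (by simp)
  simp only [Finsupp.equivFunOnFinite_symm_apply_apply, Finsupp.add_apply]
  rw [getD_append_cons_cons u v x y ha hb, add_comm, Finsupp.add_apply]

theorem wordMonomial_one_cons {k : ℕ} [NeZero k] (v : List ℕ) :
    wordMonomial k (1 :: v) = X 0 * wordMonomial k (0 :: v) := by
  rw [wordMonomial, wordMonomial, X, monomial_mul, one_mul]
  refine congrArg (monomial · 1) (Finsupp.ext fun j => ?_)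
  rw [Finsupp.add_apply]
  simp only [Finsupp.equivFunOnFinite_symm_apply_apply]
  rcases eq_or_ne j 0 with rfl | hj
  · simp
  · rw [Finsupp.single_eq_of_ne hj]
    obtain ⟨m, hm⟩ : ∃ m, (j : ℕ) = m + 1 :=
      ⟨(j : ℕ) - 1, by have : (j : ℕ) ≠ 0 := fun h => hj (Fin.ext (by simpa using h)); omega⟩
    simp [hm]

theorem rename_swap_wordMonomial {k : ℕ} (u v : List ℕ) {a b : Fin k}
    (ha : (a : ℕ) = u.length) (hb : (b : ℕ) = u.length + 1) :
    rename (Equiv.swap a b) (wordMonomial k (u ++ 0 :: 0 :: v)) =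
      wordMonomial k (u ++ 0 :: 0 :: v) := by
  rw [wordMonomial, rename_monomial]
  refine congrArg (monomial · 1) (Finsupp.ext fun j => ?_)
  rw [Finsupp.mapDomain_equiv_apply, Equiv.symm_swap]
  simp only [Finsupp.equivFunOnFinite_symm_apply_apply]
  rw [Equiv.swap_apply_def]
  have ha0 : (u ++ 0 :: 0 :: v).getD a 0 = 0 := by
    rw [ha, List.getD_append_right _ _ _ _ le_rfl]; simp
  have hb0 : (u ++ 0 :: 0 :: v).getD b 0 = 0 := by
    rw [hb, List.getD_append_right _ _ _ _ (by omega)]; simp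
  split_ifs with h1 h2
  · rw [h1, ha0, hb0]
  · rw [h2, ha0, hb0]
  · rfl

theorem wordMonomial_mem_Rspace {k : ℕ} {w : List ℕ} (hw : ∀ a ∈ w, a ≤ 2) :
    wordMonomial k w ∈ Rspace k := by
  refine monomial_mem_Rspace fun j => ?_
  simp only [Finsupp.equivFunOnFinite_symm_apply_apply]
  rcases Nat.lt_or_ge j w.length with h | h
  · rw [List.getD_eq_getElem _ _ h]
    exact hw _ (List.getElem_mem h)
  · rw [List.getD_eq_default _ _ h]
    omega

/-- `BDset` as a submodule. -/
noncomputable def BDsubmodule (k : ℕ) [NeZero k] (η : ℝ) :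
    Submodule ℂ (MvPolynomial (Fin k) ℂ) where
  carrier := BDset k η
  zero_mem' := ⟨zero_mem _, 0, by simp, by simp, by simp, by simp⟩
  add_mem' := by
    rintro p q ⟨hp, F, hF0, hF0', hF, hpF⟩ ⟨hq, G, hG0, hG0', hG, hqG⟩
    refine ⟨add_mem hp hq, F + G, ?_, ?_, fun i hi => ⟨?_, ?_⟩, ?_⟩
    · rw [Pi.add_apply, map_add, hF0, hG0]
    · rw [Pi.add_apply, mul_add]
      exact add_mem hF0' hG0'
    · rw [Pi.add_apply, map_add, (hF i hi).1, (hG i hi).1]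
    · rw [Pi.add_apply, mul_add]
      exact add_mem (hF i hi).2 (hG i hi).2
    · simp only [Pi.add_apply, mul_add, Finset.sum_add_distrib]
      rw [hpF, hqG]
      abel
  smul_mem' := by
    rintro c p ⟨hp, F, hF0, hF0', hF, hpF⟩
    refine ⟨Submodule.smul_mem _ c hp, c • F, ?_, ?_, fun i hi => ⟨?_, ?_⟩, ?_⟩
    · rw [Pi.smul_apply, map_smul, hF0]
    · rw [Pi.smul_apply, mul_smul_comm]
      exact Submodule.smul_mem _ c hF0'
    · rw [Pi.smul_apply, map_smul, (hF i hi).1]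
    · rw [Pi.smul_apply, mul_smul_comm]
      exact Submodule.smul_mem _ c (hF i hi).2
    · simp only [Pi.smul_apply, mul_smul_comm, ← Finset.smul_sum]
      rw [hpF, smul_add]

theorem bulk_mem_BDsubmodule {k : ℕ} [NeZero k] (η : ℝ) {a b : Fin k} (hab : (b : ℕ) = a + 1)
    {G : MvPolynomial (Fin k) ℂ} (hG : rename (Equiv.swap a b) G = G)
    (h : (X a - X b - 1) * G ∈ Rspace k) : (X a - X b - 1) * G ∈ BDsubmodule k η := by
  have hb : b ≠ 0 := by rintro rfl; simp at hab
  obtain rfl : b - 1 = a := Fin.ext (by have := val_eq_val_sub_one_add_one hb; omega)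
  refine ⟨h, Pi.single b G, ?_, ?_, fun i hi => ?_, ?_⟩
  · simp [Pi.single_eq_of_ne hb.symm]
  · simp [Pi.single_eq_of_ne hb.symm]
  · rcases eq_or_ne i b with rfl | hib
    · rw [Pi.single_eq_same]
      exact ⟨hG, h⟩
    · simp [Pi.single_eq_of_ne hib]
  · rw [Pi.single_eq_of_ne hb.symm, mul_zero, zero_add,
      Finset.sum_eq_single_of_mem b (by simp [hb]), Pi.single_eq_same]
    intro i _ hib
    rw [Pi.single_eq_of_ne hib, mul_zero]

theorem boundary_mem_BDsubmodule {k : ℕ} [NeZero k] (η : ℝ) {G : MvPolynomial (Fin k) ℂ}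
    (hG : aeval (fun j : Fin k => if j = 0 then -(X 0) else X j) G = G)
    (h : (X 0 + C (η : ℂ)) * G ∈ Rspace k) : (X 0 + C (η : ℂ)) * G ∈ BDsubmodule k η := by
  refine ⟨h, Pi.single 0 G, ?_, ?_, fun i hi => ?_, ?_⟩
  · rw [Pi.single_eq_same, hG]
  · rwa [Pi.single_eq_same]
  · simp [Pi.single_eq_of_ne hi]
  · rw [Pi.single_eq_same, Finset.sum_eq_zero, add_zero]
    intro i hi
    rw [Pi.single_eq_of_ne (Finset.mem_filter.1 hi).2, mul_zero]

/-- Every word of exponents, cut down to letters in `{0, 1, 2}`. -/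
def truncateWord (w : List ℕ) : List ℕ := w.map (min 2)

/-- The class modulo `BD_k` of the monomial of a word with letters in `{0, 1, 2}`. -/
noncomputable def wordClass (k : ℕ) [NeZero k] (η : ℝ) (w : List ℕ) :
    MvPolynomial (Fin k) ℂ ⧸ BDsubmodule k η :=
  (BDsubmodule k η).mkQ (wordMonomial k (truncateWord w))

theorem wordMonomial_truncateWord_mem_Rspace {k : ℕ} (w : List ℕ) :
    wordMonomial k (truncateWord w) ∈ Rspace k :=
  wordMonomial_mem_Rspace fun a ha => by
    obtain ⟨b, -, rfl⟩ := List.mem_map.1 ha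
    exact min_le_left _ _

theorem truncateWord_append (u : List ℕ) (x y : ℕ) (hx : x ≤ 2) (hy : y ≤ 2) (v : List ℕ) :
    truncateWord (u ++ x :: y :: v) = truncateWord u ++ x :: y :: truncateWord v := by
  simp [truncateWord, hx, hy]

theorem wordRelations_wordClass (k : ℕ) [NeZero k] (η : ℝ) :
    WordRelations k (η : ℂ) (wordClass k η) := by
  have hbulk : ∀ u v : List ℕ, u.length + v.length + 2 = k → ∃ a b : Fin k,
      (b : ℕ) = a + 1 ∧
      rename (Equiv.swap a b) (wordMonomial k (truncateWord (u ++ 0 :: 0 :: v))) =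
        wordMonomial k (truncateWord (u ++ 0 :: 0 :: v)) ∧
      ∀ x y, x ≤ 2 → y ≤ 2 → wordMonomial k (truncateWord (u ++ x :: y :: v)) =
        X a ^ x * X b ^ y * wordMonomial k (truncateWord (u ++ 0 :: 0 :: v)) := by
    intro u v huv
    refine ⟨⟨u.length, by omega⟩, ⟨u.length + 1, by omega⟩, rfl, ?_, fun x y hx hy => ?_⟩
    · rw [truncateWord_append u 0 0 (by omega) (by omega)]
      exact rename_swap_wordMonomial _ _ (by simp [truncateWord]) (by simp [truncateWord])
    · rw [truncateWord_append u 0 0 (by omega) (by omega), truncateWord_append u x y hx hy]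
      exact wordMonomial_append _ _ x y (by simp [truncateWord]) (by simp [truncateWord])
  have hR : ∀ w, wordMonomial k (truncateWord w) ∈ Rspace k := wordMonomial_truncateWord_mem_Rspace
  refine ⟨fun v hv => ?_, fun u v huv => ?_, fun u v huv => ?_, fun u v huv => ?_⟩
  · have h1 : wordMonomial k (truncateWord (1 :: v)) =
        X 0 * wordMonomial k (truncateWord (0 :: v)) := by
      simpa [truncateWord] using wordMonomial_one_cons (k := k) (v.map (min 2))
    have heq : (X 0 + C (η : ℂ)) * wordMonomial k (truncateWord (0 :: v)) =
        wordMonomial k (truncateWord (1 :: v)) + (η : ℂ) • wordMonomial k (truncateWord (0 :: v)) := by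
      rw [h1, smul_eq_C_mul]
      ring
    have hmem := boundary_mem_BDsubmodule η (G := wordMonomial k (truncateWord (0 :: v))) ?_
      (by rw [heq]; exact add_mem (hR _) (Submodule.smul_mem _ _ (hR _)))
    · rw [heq, ← Submodule.Quotient.mk_eq_zero, Submodule.Quotient.mk_add,
        Submodule.Quotient.mk_smul] at hmem
      rw [neg_smul]
      exact eq_neg_of_add_eq_zero_left hmem
    · rw [wordMonomial, aeval_monomial, monomial_eq, map_one, map_one, one_mul, one_mul,
        Finsupp.prod_fintype _ _ (by simp), Finsupp.prod_fintype _ _ (by simp)]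
      refine Finset.prod_congr rfl fun j _ => ?_
      split_ifs with hj
      · subst hj
        simp [truncateWord]
      · rfl
  · obtain ⟨a, b, hab, hW, hX⟩ := hbulk u v huv
    set W := wordMonomial k (truncateWord (u ++ 0 :: 0 :: v))
    have heq : (X a - X b - 1) * W = wordMonomial k (truncateWord (u ++ 1 :: 0 :: v)) -
        (wordMonomial k (truncateWord (u ++ 0 :: 1 :: v)) + W) := by
      rw [hX 1 0 (by omega) (by omega), hX 0 1 (by omega) (by omega)]
      ring
    have hmem := bulk_mem_BDsubmodule η hab hW
      (by rw [heq]; exact sub_mem (hR _) (add_mem (hR _) (hR _)))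
    rw [heq] at hmem
    exact (Submodule.Quotient.eq _).2 hmem
  · obtain ⟨a, b, hab, hW, hX⟩ := hbulk u v huv
    set W := wordMonomial k (truncateWord (u ++ 0 :: 0 :: v))
    have heq : (X a - X b - 1) * ((X a + X b) * W) =
        wordMonomial k (truncateWord (u ++ 2 :: 0 :: v)) -
        (wordMonomial k (truncateWord (u ++ 0 :: 2 :: v)) +
          wordMonomial k (truncateWord (u ++ 1 :: 0 :: v)) +
          wordMonomial k (truncateWord (u ++ 0 :: 1 :: v))) := by
      rw [hX 1 0 (by omega) (by omega), hX 0 1 (by omega) (by omega),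
        hX 2 0 (by omega) (by omega), hX 0 2 (by omega) (by omega)]
      ring
    have hmem := bulk_mem_BDsubmodule η hab (G := (X a + X b) * W)
      (by simp [hW, add_comm])
      (by rw [heq]; exact sub_mem (hR _) (add_mem (add_mem (hR _) (hR _)) (hR _)))
    rw [heq] at hmem
    exact (Submodule.Quotient.eq _).2 hmem
  · obtain ⟨a, b, hab, hW, hX⟩ := hbulk u v huv
    set W := wordMonomial k (truncateWord (u ++ 0 :: 0 :: v))
    have heq : (X a - X b - 1) * (X a * X b * W) =
        wordMonomial k (truncateWord (u ++ 2 :: 1 :: v)) -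
        (wordMonomial k (truncateWord (u ++ 1 :: 2 :: v)) +
          wordMonomial k (truncateWord (u ++ 1 :: 1 :: v))) := by
      rw [hX 1 1 (by omega) (by omega), hX 2 1 (by omega) (by omega),
        hX 1 2 (by omega) (by omega)]
      ring
    have hmem := bulk_mem_BDsubmodule η hab (G := X a * X b * W)
      (by simp [hW, mul_comm])
      (by rw [heq]; exact sub_mem (hR _) (add_mem (hR _) (hR _)))
    rw [heq] at hmem
    exact (Submodule.Quotient.eq _).2 hmem

/-- The monomial `z_{s+1}²⋯z_k²`. -/
noncomputable def sortedMonomial (k s : ℕ) : MvPolynomial (Fin k) ℂ :=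
  wordMonomial k (List.replicate s 0 ++ List.replicate (k - s) 2)

theorem getD_replicate_append_replicate {k s : ℕ} (hs : s ≤ k) (j : Fin k) :
    (List.replicate s 0 ++ List.replicate (k - s) 2).getD j 0 = if (j : ℕ) < s then 0 else 2 := by
  split_ifs with h
  · rw [List.getD_append _ _ _ _ (by simpa using h)]
    simp [List.getD_eq_getElem?_getD, h]
  · rw [List.getD_append_right _ _ _ _ (by simpa using h), List.length_replicate,
      List.getD_eq_getElem _ _ (by simp; omega), List.getElem_replicate]

theorem shFunctional_sortedMonomial {k s n : ℕ} (hs : s ≤ k) (hn : n ≤ s) (η : ℝ) :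
    shFunctional k η (k - n) (sortedMonomial k s) = if n = s then 1 else 0 := by
  have hcard : (Finset.univ.filter fun j : Fin k => (j : ℕ) < s).card = s := by
    rw [Fin.card_filter_val_lt, min_eq_right hs]
  have hterm : ∀ S : Finset (Fin k), S.card = n → subsetWeight (η : ℂ) S
      (Finsupp.equivFunOnFinite.symm fun j : Fin k =>
        (List.replicate s 0 ++ List.replicate (k - s) 2).getD j 0) =
      if S = Finset.univ.filter (fun j : Fin k => (j : ℕ) < s) then 1 else 0 := by
    intro S hS
    simp only [subsetWeight, Finsupp.equivFunOnFinite_symm_apply_apply,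
      getD_replicate_append_replicate hs]
    by_cases hsub : (Finset.univ.filter fun j : Fin k => (j : ℕ) < s) ⊆ S
    · have heq : (Finset.univ.filter fun j : Fin k => (j : ℕ) < s) = S :=
        Finset.eq_of_subset_of_card_le hsub (by rw [hcard, hS]; exact hn)
      rw [if_pos heq.symm]
      refine Finset.prod_eq_one fun j _ => ?_
      rw [← heq]
      by_cases hj : (j : ℕ) < s <;> simp [hj]
    · rw [if_neg fun h => hsub h.ge]
      obtain ⟨j, hj, hjS⟩ := Finset.not_subset.1 hsub
      refine Finset.prod_eq_zero (Finset.mem_univ j) ?_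
      simp [hjS, (Finset.mem_filter.1 hj).2]
  rw [sortedMonomial, wordMonomial, shFunctional_monomial (Nat.sub_le k n),
    Nat.sub_sub_self (hn.trans hs),
    Finset.sum_congr rfl fun S hS => hterm S (Finset.mem_powersetCard.1 hS).2,
    Finset.sum_ite_eq']
  simp [Finset.mem_powersetCard, hcard, eq_comm]

theorem mkQ_mem_span_sortedMonomial {k : ℕ} [NeZero k] (η : ℝ) {p : MvPolynomial (Fin k) ℂ}
    (hp : p ∈ Rspace k) :
    (BDsubmodule k η).mkQ p ∈ Submodule.span ℂ
      ((fun s => (BDsubmodule k η).mkQ (sortedMonomial k s)) '' Finset.range (k + 1)) := by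
  suffices h : Rspace k ≤ (Submodule.span ℂ ((fun s => (BDsubmodule k η).mkQ
      (sortedMonomial k s)) '' Finset.range (k + 1))).comap (BDsubmodule k η).mkQ from h hp
  refine Submodule.span_le.2 ?_
  rintro _ ⟨e, he, rfl⟩
  have hw : ∀ a ∈ List.ofFn e, a ≤ 2 := by
    intro a ha
    obtain ⟨j, rfl⟩ := (List.mem_ofFn' _ _).1 ha
    exact he j
  have htrunc : ∀ w : List ℕ, (∀ a ∈ w, a ≤ 2) → truncateWord w = w := by
    intro w hw
    exact (List.map_congr_left fun a ha => min_eq_right (hw a ha)).trans (List.map_id' w)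
  have hmem := (wordRelations_wordClass k η).append_mem _ hw [] (by simp)
  rw [List.append_nil, wordClass, htrunc _ hw, List.length_ofFn] at hmem
  have hmon : wordMonomial k (List.ofFn e) = monomial e 1 := by
    rw [wordMonomial]
    congr 1
    ext j
    simp
  rw [hmon] at hmem
  refine Submodule.span_mono ?_ hmem
  rintro _ ⟨s, t, hst, -, rfl⟩
  refine ⟨s, by simp; omega, ?_⟩
  obtain rfl : t = k - s := by omega
  simp only [wordClass, List.append_nil, sortedMonomial]
  rw [htrunc]
  intro a ha
  rcases List.mem_append.1 ha with h | h <;> rw [List.eq_of_mem_replicate h] <;> omega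

/-- Theorem 3.4 of the paper: `BD_k = SH_k`. -/
theorem BD_eq_SH (k : ℕ) [NeZero k] (η : ℝ) (hη : 0 < η) :
    BDset k η = SHset k η := by
  ext p
  constructor
  · intro hp
    refine ⟨hp.1, fun r hr => ?_⟩
    rw [← shFunctional_apply]
    exact shFunctional_eq_zero_of_mem_BDset hr η hp
  · rintro ⟨hpR, hp⟩
    obtain ⟨c, hc⟩ : ∃ c : ℕ → ℂ, ∑ s ∈ Finset.range (k + 1),
        c s • (BDsubmodule k η).mkQ (sortedMonomial k s) = (BDsubmodule k η).mkQ p := by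
      obtain ⟨c, hc⟩ := (Submodule.mem_span_image_finset_iff_exists_fun ℂ).1
        (mkQ_mem_span_sortedMonomial η hpR)
      refine ⟨fun s => if h : s ∈ Finset.range (k + 1) then c ⟨s, h⟩ else 0, ?_⟩
      rw [← hc, ← Finset.sum_coe_sort]
      exact Finset.sum_congr rfl fun s _ => by simp only [dif_pos s.2]
    have hmem : p - ∑ s ∈ Finset.range (k + 1), c s • sortedMonomial k s ∈ BDsubmodule k η := by
      rw [← Submodule.Quotient.mk_eq_zero, ← Submodule.mkQ_apply, map_sub, map_sum, sub_eq_zero,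
        ← hc]
      simp only [map_smul]
    have hzero : ∀ r ≤ k,
        ∑ s ∈ Finset.range (k + 1), c s * shFunctional k η r (sortedMonomial k s) = 0 := by
      intro r hr
      have h := shFunctional_eq_zero_of_mem_BDset hr η hmem
      rw [map_sub, shFunctional_apply, hp r hr, zero_sub, neg_eq_zero, map_sum] at h
      simpa only [map_smul, smul_eq_mul] using h
    have hc0 : ∀ n, n ≤ k → c n = 0 := by
      intro n
      induction n using Nat.strong_induction_on with
      | _ n ih =>
        intro hn
        have h := hzero (k - n) (Nat.sub_le k n)
        rw [Finset.sum_eq_single_of_mem n (by simp; omega),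
          shFunctional_sortedMonomial hn le_rfl, if_pos rfl, mul_one] at h
        · exact h
        · intro s hs hsn
          rcases lt_or_gt_of_ne hsn with hlt | hgt
          · rw [ih s hlt (by omega), zero_mul]
          · rw [shFunctional_sortedMonomial (by simp at hs; omega) hgt.le, if_neg hsn.symm,
              mul_zero]
    rw [Finset.sum_eq_zero, sub_zero] at hmem
    · exact hmem
    · intro s hs
      rw [hc0 s (by simp at hs; omega), zero_smul]
end

section
/- For every integer k ≥ 1 and every real η > 0, the ℂ-vector space SH_k has dimension 3^k − k − 1. -/
open MvPolynomial

theorem Rspace_eq_restrictSupport (k : ℕ) :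
    Rspace k = restrictSupport ℂ {e : Fin k →₀ ℕ | ∀ j, e j ≤ 2} := by
  rw [restrictSupport_eq_span, Rspace]
  congr 1
  ext m
  simp only [Rmonomials, Set.mem_ofPred_eq, Set.mem_image, eq_comm]

/-- Exponent vectors with entries at most `2` are functions to `Fin 3`. -/
noncomputable def exponentEquiv (k : ℕ) :
    {e : Fin k →₀ ℕ | ∀ j, e j ≤ 2} ≃ (Fin k → Fin 3) where
  toFun e j := ⟨e.1 j, Nat.lt_succ_of_le (e.2 j)⟩
  invFun f := ⟨Finsupp.equivFunOnFinite.symm fun j => (f j : ℕ),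
    fun j => Nat.le_of_lt_succ (f j).2⟩
  left_inv e := by ext j; rfl
  right_inv f := by ext j; rfl

/-- The monomial basis of `Rspace k`. -/
noncomputable def Rspace.basis (k : ℕ) : Module.Basis (Fin k → Fin 3) ℂ (Rspace k) :=
  ((basisRestrictSupport ℂ {e : Fin k →₀ ℕ | ∀ j, e j ≤ 2}).reindex (exponentEquiv k)).map
    (LinearEquiv.ofEq _ _ (Rspace_eq_restrictSupport k).symm)

theorem finrank_Rspace (k : ℕ) : Module.finrank ℂ (Rspace k) = 3 ^ k := by
  simp [Module.finrank_eq_card_basis (Rspace.basis k)]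

instance Rspace.finiteDimensional (k : ℕ) : FiniteDimensional ℂ (Rspace k) :=
  Module.Basis.finiteDimensional_of_finite (Rspace.basis k)

/-- The linear functional sending `p` to the coefficient of `x₁²⋯x_r²` in `L_{r,k}(p)`. -/
noncomputable def topCoeff (k : ℕ) (η : ℝ) (r : ℕ) : MvPolynomial (Fin k) ℂ →ₗ[ℂ] ℂ :=
  lcoeff ℂ (∑ i ∈ Finset.range r, Finsupp.single i 2) ∘ₗ
    ∑ S ∈ Finset.powersetCard (k - r) (Finset.univ : Finset (Fin k)),
      (aeval (fun j : Fin k =>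
        if j ∈ S then (C (-(η : ℂ) - ((S.filter (fun i => i < j)).card : ℂ)) : MvPolynomial ℕ ℂ)
        else X (((Finset.univ \ S).filter (fun i => i < j)).card))).toLinearMap

theorem topCoeff_apply (k : ℕ) (η : ℝ) (r : ℕ) (p : MvPolynomial (Fin k) ℂ) :
    topCoeff k η r p = coeff (∑ i ∈ Finset.range r, Finsupp.single i 2) (Lmap k η r p) := by
  simp [topCoeff, Lmap, coeff_sum]

/-- The exponent vector `(2, …, 2, 0, …, 0)` with `d` entries equal to `2`. -/
noncomputable def stairExponent (k d : ℕ) : Fin k →₀ ℕ :=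
  Finsupp.equivFunOnFinite.symm fun j => if (j : ℕ) < d then 2 else 0

theorem monomial_stairExponent_mem (k d : ℕ) :
    monomial (stairExponent k d) (1 : ℂ) ∈ Rspace k :=
  Submodule.subset_span ⟨_, fun j => by simp only [stairExponent,
    Finsupp.equivFunOnFinite_symm_apply_apply]; split_ifs <;> simp, rfl⟩

theorem aeval_monomial_stairExponent {A : Type*} [CommSemiring A] [Algebra ℂ A] (k d : ℕ)
    (f : Fin k → A) :
    aeval f (monomial (stairExponent k d) (1 : ℂ)) = ∏ j ∈ Finset.univ.filter fun j : Fin k => (j : ℕ) < d, f j ^ 2 := by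
  rw [aeval_monomial, Finsupp.prod_fintype _ _ (by simp), map_one, one_mul, Finset.prod_filter]
  refine Finset.prod_congr rfl fun j _ => ?_
  by_cases h : (j : ℕ) < d <;> simp [stairExponent, h]

theorem sum_support_sum_single_range (r : ℕ) :
    ∑ i ∈ (∑ i ∈ Finset.range r, Finsupp.single i 2 : ℕ →₀ ℕ).support,
      (∑ i ∈ Finset.range r, Finsupp.single i 2 : ℕ →₀ ℕ) i = 2 * r := by
  change (∑ i ∈ Finset.range r, Finsupp.single i 2 : ℕ →₀ ℕ).degree = _
  simp [mul_comm]

/-- Each variable outside `S` contributes degree at most `2` to the substituted product. -/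
theorem coeff_prod_ite_sq_eq_zero {ι : Type*} [DecidableEq ι] (T S : Finset ι) (c : ι → ℂ)
    (n : ι → ℕ) {r : ℕ} (h : (T \ S).card < r) :
    coeff (∑ i ∈ Finset.range r, Finsupp.single i 2)
      (∏ j ∈ T, (if j ∈ S then (C (c j) : MvPolynomial ℕ ℂ) else X (n j)) ^ 2) = 0 := by
  apply coeff_eq_zero_of_totalDegree_lt
  rw [sum_support_sum_single_range]
  calc _ ≤ ∑ j ∈ T, (if j ∈ S then 0 else 2) := by
        refine (totalDegree_finsetProd _ _).trans (Finset.sum_le_sum fun j _ => ?_)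
        refine (totalDegree_pow _ _).trans ?_
        split_ifs <;> simp
    _ = 2 * (T \ S).card := by
        rw [Finset.sdiff_eq_filter, Finset.card_filter, Finset.mul_sum]
        exact Finset.sum_congr rfl fun j _ => by split_ifs <;> simp_all
    _ < 2 * r := by omega

theorem card_filter_val_lt {k d : ℕ} (h : d ≤ k) :
    (Finset.univ.filter fun j : Fin k => (j : ℕ) < d).card = d := by
  rw [Fin.card_filter_val_lt, min_eq_right h]

theorem topCoeff_stair_of_lt {k d r : ℕ} (η : ℝ) (hr : r ≤ k) (h : d < r) :
    topCoeff k η r (monomial (stairExponent k d) 1) = 0 := by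
  rw [topCoeff_apply, Lmap, coeff_sum]
  refine Finset.sum_eq_zero fun S _ => ?_
  rw [aeval_monomial_stairExponent]
  refine coeff_prod_ite_sq_eq_zero _ _ _ _ (lt_of_le_of_lt (Finset.card_le_card
    Finset.sdiff_subset) ?_)
  rwa [card_filter_val_lt (h.le.trans hr)]

theorem topCoeff_stair_self {k r : ℕ} (η : ℝ) (hr : r ≤ k) :
    topCoeff k η r (monomial (stairExponent k r) 1) = 1 := by
  set T : Finset (Fin k) := Finset.univ.filter fun j : Fin k => (j : ℕ) < r with hT
  have hTcard : T.card = r := card_filter_val_lt hr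
  rw [topCoeff_apply, Lmap, coeff_sum, Finset.sum_eq_single Tᶜ]
  · rw [aeval_monomial_stairExponent, ← hT]
    have hprod : ∀ j ∈ T, (if j ∈ Tᶜ then
        (C (-(η : ℂ) - ((Tᶜ.filter (fun i => i < j)).card : ℂ)) : MvPolynomial ℕ ℂ)
        else X (((Finset.univ \ Tᶜ).filter (fun i => i < j)).card)) ^ 2
        = monomial (Finsupp.single (j : ℕ) 2) 1 := by
      intro j hj
      have hj' : (j : ℕ) < r := by simpa [hT] using hj
      have hrank : (T.filter (fun i => i < j)).card = j := by
        rw [hT, Finset.filter_filter]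
        rw [show (Finset.univ.filter fun i : Fin k => (i : ℕ) < r ∧ i < j)
          = Finset.univ.filter fun i : Fin k => (i : ℕ) < (j : ℕ) by
            ext i; simp only [Finset.mem_filter, Finset.mem_univ, true_and, Fin.lt_def]; omega]
        exact card_filter_val_lt j.2.le
      rw [if_neg (by simpa using hj), ← Finset.compl_eq_univ_sdiff, compl_compl, hrank,
        X_pow_eq_monomial]
    rw [Finset.prod_congr rfl hprod]
    have hsum : ∑ i ∈ Finset.range r, Finsupp.single i 2
        = ∑ j ∈ T, (Finsupp.single (j : ℕ) 2 : ℕ →₀ ℕ) := by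
      refine (Finset.sum_nbij (fun j : Fin k => (j : ℕ)) ?_ ?_ ?_ fun _ _ => rfl).symm
      · intro j hj; simpa [hT] using hj
      · exact fun _ _ _ _ h => Fin.ext h
      · intro i hi
        have hi' : i < r := by simpa using hi
        exact ⟨⟨i, hi'.trans_le hr⟩, by simpa [hT] using hi', rfl⟩
    rw [hsum, ← monomial_sum_one, coeff_monomial, if_pos rfl]
  · intro S hS hne
    rw [aeval_monomial_stairExponent, ← hT]
    apply coeff_prod_ite_sq_eq_zero
    rw [Finset.mem_powersetCard_univ] at hS
    have hScard : Sᶜ.card = r := by rw [Finset.card_compl, hS, Fintype.card_fin]; omega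
    refine lt_of_le_of_ne ((Finset.card_le_card Finset.sdiff_subset).trans hTcard.le) fun h => ?_
    have h₁ : T \ S = T := Finset.eq_of_subset_of_card_le Finset.sdiff_subset (by omega)
    have h₂ : T \ S = Sᶜ := Finset.eq_of_subset_of_card_le
      (fun j hj => by simpa using (Finset.mem_sdiff.mp hj).2) (by omega)
    exact hne (by rw [← h₁, h₂, compl_compl])
  · intro h
    exact absurd (by simp [Finset.card_compl, hTcard]) h

/-- The functionals `topCoeff k η r`, `0 ≤ r ≤ k`, restricted to `Rspace k`. -/
noncomputable def topCoeffs (k : ℕ) (η : ℝ) : Rspace k →ₗ[ℂ] (Fin (k + 1) → ℂ) :=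
  LinearMap.pi fun r => topCoeff k η r ∘ₗ (Rspace k).subtype

theorem topCoeffs_surjective (k : ℕ) (η : ℝ) : Function.Surjective (topCoeffs k η) := by
  let M : Matrix (Fin (k + 1)) (Fin (k + 1)) ℂ :=
    fun r d => topCoeff k η r (monomial (stairExponent k d) 1)
  have hM : M.BlockTriangular id := fun r d h =>
    topCoeff_stair_of_lt η (Nat.le_of_lt_succ r.2) h
  have hdet : IsUnit M.det := by
    rw [Matrix.det_of_isUpperTriangular hM, Finset.prod_eq_one fun r _ =>
      topCoeff_stair_self η (Nat.le_of_lt_succ r.2)]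
    exact isUnit_one
  intro v
  refine ⟨∑ d, (M⁻¹.mulVec v) d • ⟨_, monomial_stairExponent_mem k d⟩, ?_⟩
  have hv : M.mulVec (M⁻¹.mulVec v) = v := by
    rw [Matrix.mulVec_mulVec, Matrix.mul_nonsing_inv _ hdet, Matrix.one_mulVec]
  rw [map_sum]
  conv_rhs => rw [← hv]
  ext r
  simp [topCoeffs, Matrix.mulVec, dotProduct, M, mul_comm]

theorem SHset_eq_map_ker (k : ℕ) (η : ℝ) :
    SHset k η = (LinearMap.ker (topCoeffs k η)).map (Rspace k).subtype := by
  ext p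
  simp [SHset, topCoeffs, funext_iff, topCoeff_apply, Fin.forall_iff, and_comm]

/-- Lemma 3.7 of the paper: the space `SH_k` has dimension `3^k − k − 1`. -/
theorem SH_finrank (k : ℕ) [NeZero k] (η : ℝ) (hη : 0 < η) :
    Module.finrank ℂ (Submodule.span ℂ (SHset k η)) = 3 ^ k - k - 1 := by
  rw [SHset_eq_map_ker, Submodule.span_eq, Submodule.finrank_map_subtype_eq]
  have h := (topCoeffs k η).finrank_range_add_finrank_ker
  rw [LinearMap.range_eq_top.mpr (topCoeffs_surjective k η), finrank_top,
    Module.finrank_fin_fun, finrank_Rspace] at h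
  omega
end

section
/- For every 1 ≤ i ≤ k−1 and every choice of exponents i_1,…,i_{i−1} ∈ {0,1,2}, the polynomial (∏_{j=1}^{i−1} z_j^{i_j}) · ( z_i z_{i+1}^2⋯z_{k−1}^2 z_k − (k−i−1)! · z_i z_{i+1}⋯z_k ) belongs to BD_k + span(L_k^2). -/
open MvPolynomial

/-- The monomial `∏ⱼ Xⱼ ^ e j` with exponents given by a function on `Fin k`. -/
noncomputable def expMonomial {k : ℕ} (e : Fin k → ℕ) : MvPolynomial (Fin k) ℂ :=
  monomial (Finsupp.equivFunOnFinite.symm e) 1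

theorem expMonomial_eq_prod {k : ℕ} (e : Fin k → ℕ) :
    expMonomial e = ∏ j, (X j : MvPolynomial (Fin k) ℂ) ^ e j := by
  rw [expMonomial, monomial_eq, Finsupp.prod_fintype _ _ (by simp)]
  simp

theorem X_mul_expMonomial {k : ℕ} (e : Fin k → ℕ) (a : Fin k) :
    X a * expMonomial e = expMonomial (Function.update e a (e a + 1)) := by
  rw [expMonomial, expMonomial, X, monomial_mul, one_mul]
  congr 2
  ext j
  by_cases h : j = a
  · subst h
    simp [add_comm]
  · simp [h]

theorem rename_swap_expMonomial {k : ℕ} (e : Fin k → ℕ) {a b : Fin k} (h : e a = e b) :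
    rename (Equiv.swap a b) (expMonomial e) = expMonomial e := by
  rw [expMonomial, rename_monomial]
  congr 2
  ext j
  rw [Finsupp.mapDomain_equiv_apply]
  simp only [Equiv.symm_swap, Finsupp.equivFunOnFinite_symm_apply_apply]
  rcases eq_or_ne j a with rfl | ha
  · simp [h]
  rcases eq_or_ne j b with rfl | hb
  · simp [h]
  rw [Equiv.swap_apply_of_ne_of_ne ha hb]

theorem expMonomial_mem_Rspace {k : ℕ} {e : Fin k → ℕ} (he : ∀ j, e j ≤ 2) :
    expMonomial e ∈ Rspace k :=
  Submodule.subset_span ⟨_, by simpa using he, rfl⟩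

theorem sub_mul_mem_BDset {k : ℕ} [NeZero k] (η : ℝ) {b : Fin k} (hb : b ≠ 0)
    {G : MvPolynomial (Fin k) ℂ} (hG : rename (Equiv.swap (b - 1) b) G = G)
    (hR : (X (b - 1) - X b - 1) * G ∈ Rspace k) :
    (X (b - 1) - X b - 1) * G ∈ BDset k η := by
  refine ⟨hR, Pi.single b G, ?_, ?_, ?_, ?_⟩
  · simp [Pi.single_eq_of_ne hb.symm]
  · simp [Pi.single_eq_of_ne hb.symm]
  · intro i _
    rcases eq_or_ne i b with rfl | hi
    · simpa using ⟨hG, hR⟩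
    · simp [Pi.single_eq_of_ne hi]
  · rw [Pi.single_eq_of_ne hb.symm, mul_zero, zero_add,
      Finset.sum_eq_single_of_mem b (by simpa using hb)]
    · simp
    · intro i _ hi
      simp [Pi.single_eq_of_ne hi]

theorem expMonomial_exchange_mem_BDset {k : ℕ} [NeZero k] (η : ℝ) {b : Fin k} (hb : b ≠ 0)
    {e : Fin k → ℕ} (he : ∀ j, e j ≤ 2) (h1 : e (b - 1) = 1) (h2 : e b = 1) :
    expMonomial (Function.update e (b - 1) 2) - expMonomial (Function.update e b 2)
      - expMonomial e ∈ BDset k η := by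
  have key : expMonomial (Function.update e (b - 1) 2) - expMonomial (Function.update e b 2)
      - expMonomial e = (X (b - 1) - X b - 1) * expMonomial e := by
    rw [sub_mul, sub_mul, X_mul_expMonomial, X_mul_expMonomial, h1, h2, one_mul]
  have hu (a : Fin k) (j : Fin k) : Function.update e a 2 j ≤ 2 := by
    rw [Function.update_apply]
    split_ifs
    · exact le_rfl
    · exact he j
  rw [key]
  refine sub_mul_mem_BDset η hb (rename_swap_expMonomial e (h1.trans h2.symm)) ?_
  rw [← key]
  exact sub_mem (sub_mem (expMonomial_mem_Rspace (hu _)) (expMonomial_mem_Rspace (hu _)))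
    (expMonomial_mem_Rspace he)

/-- A single exponent `2` followed only by exponents `1` can be lowered to `1`, at the cost of a
factor equal to the number of variables to its right. -/
theorem expMonomial_update_two_sub_mem {k : ℕ} [NeZero k] (η : ℝ) (n : ℕ) :
    ∀ (p : Fin k), (p : ℕ) + n + 1 = k → ∀ e : Fin k → ℕ, (∀ j, e j ≤ 2) →
      (∀ j, p ≤ j → e j = 1) →
      expMonomial (Function.update e p 2) - (n : ℂ) • expMonomial e
        ∈ Submodule.span ℂ (BDset k η) ⊔ Submodule.span ℂ (Lset k 2) := by
  induction n with
  | zero =>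
    intro p hp e he h1
    rw [Nat.cast_zero, zero_smul, sub_zero]
    refine Submodule.mem_sup_right (Submodule.subset_span ⟨_, ?_, ?_, rfl⟩)
    · intro j
      rw [Finsupp.equivFunOnFinite_symm_apply_apply, Function.update_apply]
      split_ifs
      · exact le_rfl
      · exact he j
    · intro j hj
      obtain rfl : j = p := Fin.ext (by omega)
      simp
  | succ n ih =>
    intro p hp e he h1
    obtain ⟨b, hb⟩ : ∃ b : Fin k, (b : ℕ) = p + 1 := ⟨⟨p + 1, by omega⟩, rfl⟩
    have hb0 : b ≠ 0 := by
      rintro rfl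
      simp at hb
    have hbp : b - 1 = p := Fin.ext (by rw [Fin.val_sub_one_of_ne_zero hb0]; omega)
    have hpb : p ≤ b := Fin.le_def.2 (by omega)
    have hstep := expMonomial_exchange_mem_BDset η hb0 he
      (by rw [hbp]; exact h1 p le_rfl) (h1 b hpb)
    rw [hbp] at hstep
    have hsum := add_mem
      (Submodule.mem_sup_left (Submodule.subset_span hstep))
      (ih b (by omega) e he fun j hj => h1 j (hpb.trans hj))
    convert hsum using 1
    push_cast
    module

/-- A block of exponents `2` followed only by exponents `1` can be lowered to exponents `1`. -/
theorem expMonomial_block_sub_mem {k : ℕ} [NeZero k] (η : ℝ) {i : ℕ} {e : Fin k → ℕ}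
    (he : ∀ j, e j ≤ 2) (h1 : ∀ j : Fin k, i ≤ j → e j = 1) (m : ℕ) (hm : i + m < k) :
    expMonomial (fun j => if i ≤ (j : ℕ) ∧ (j : ℕ) < i + m then 2 else e j)
        - (((k - i - 1).descFactorial m : ℕ) : ℂ) • expMonomial e
      ∈ Submodule.span ℂ (BDset k η) ⊔ Submodule.span ℂ (Lset k 2) := by
  induction m with
  | zero =>
    have h : (fun j : Fin k => if i ≤ (j : ℕ) ∧ (j : ℕ) < i + 0 then 2 else e j) = e :=
      funext fun j => if_neg (by omega)
    rw [h]
    simp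
  | succ m ih =>
    have hstep := expMonomial_update_two_sub_mem η (k - i - 1 - m) ⟨i + m, by omega⟩
      (by dsimp only; omega)
      (fun j => if i ≤ (j : ℕ) ∧ (j : ℕ) < i + m then 2 else e j)
      (fun j => by
        split_ifs
        · exact le_rfl
        · exact he j)
      (fun j hj => by
        have hj' : i + m ≤ (j : ℕ) := hj
        rw [if_neg (by omega)]
        exact h1 j (by omega))
    have hupd : Function.update
        (fun j : Fin k => if i ≤ (j : ℕ) ∧ (j : ℕ) < i + m then 2 else e j) ⟨i + m, by omega⟩ 2
        = fun j : Fin k => if i ≤ (j : ℕ) ∧ (j : ℕ) < i + (m + 1) then 2 else e j := by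
      funext j
      simp only [Function.update_apply, Fin.ext_iff]
      split_ifs <;> first | rfl | omega
    rw [hupd] at hstep
    convert add_mem hstep (Submodule.smul_mem _ ((k - i - 1 - m : ℕ) : ℂ) (ih (by omega)))
      using 1
    rw [Nat.descFactorial_succ]
    push_cast
    module

/-- Lemma 4.3 of the paper: for `1 ≤ i ≤ k−1` and exponents `i_j ∈ {0,1,2}`,
`(∏_{j=1}^{i−1} z_j^{i_j}) · (z_i z_{i+1}²⋯z_{k−1}² z_k − (k−i−1)! z_i z_{i+1}⋯z_k)
  ∈ BD_k + span(L_k²)`. -/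
theorem foil_down (k : ℕ) [NeZero k] (η : ℝ) (hη : 0 < η)
    (i : ℕ) (hi1 : 1 ≤ i) (hi2 : i ≤ k - 1) (e : Fin k → ℕ) (he : ∀ j, e j ≤ 2) :
    (∏ j ∈ Finset.univ.filter (fun j : Fin k => (j : ℕ) < i - 1), X j ^ e j) *
        (X (⟨i - 1, by omega⟩ : Fin k) *
            (∏ j ∈ Finset.univ.filter (fun j : Fin k => i ≤ (j : ℕ) ∧ (j : ℕ) < k - 1),
              X j ^ 2) * X (⟨k - 1, by omega⟩ : Fin k) -
          C (((k - i - 1).factorial : ℂ)) *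
            ∏ j ∈ Finset.univ.filter (fun j : Fin k => i - 1 ≤ (j : ℕ)), X j)
      ∈ Submodule.span ℂ (BDset k η) ⊔ Submodule.span ℂ (Lset k 2) := by
  have hmem := expMonomial_block_sub_mem η (i := i)
    (e := fun j : Fin k => if (j : ℕ) < i - 1 then e j else 1)
    (fun j => by
      split_ifs
      · exact he j
      · exact one_le_two)
    (fun j hj => if_neg (by omega)) (k - i - 1) (by omega)
  rw [Nat.descFactorial_self] at hmem
  convert hmem using 1
  rw [mul_sub, ← C_mul', mul_left_comm _ (C _), expMonomial_eq_prod, expMonomial_eq_prod]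
  have hX (a : Fin k) : (X a : MvPolynomial (Fin k) ℂ) = ∏ j, if j = a then X j else 1 := by
    simp
  congr 1
  · rw [hX ⟨i - 1, by omega⟩, hX ⟨k - 1, by omega⟩]
    simp only [Finset.prod_filter, ← Finset.prod_mul_distrib]
    refine Finset.prod_congr rfl fun j _ => ?_
    have hj := j.isLt
    simp only [Fin.ext_iff]
    split_ifs <;> first | omega | simp
  · congr 1
    simp only [Finset.prod_filter, ← Finset.prod_mul_distrib]
    refine Finset.prod_congr rfl fun j _ => ?_
    split_ifs <;> first | omega | simp
end

section
/- For every 1 ≤ i ≤ k and every choice of exponents i_1,…,i_{i−1} ∈ {0,1,2}, the polynomial (∏_{j=1}^{i−1} z_j^{i_j}) · ( z_i z_{i+1}⋯z_k − (1/(k−i)!) · z_i^2 z_{i+1}^2⋯z_{k−1}^2 z_k ) belongs to BD_k + span(L_k^2). -/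
open MvPolynomial

open Function in
theorem X_mul_prod_X_pow {k : ℕ} (f : Fin k → ℕ) (p : Fin k) :
    (X p : MvPolynomial (Fin k) ℂ) * ∏ j, X j ^ f j = ∏ j, X j ^ update f p (f p + 1) j := by
  rw [← Finset.mul_prod_erase _ _ (Finset.mem_univ p),
    ← Finset.mul_prod_erase Finset.univ (fun j => X j ^ update f p (f p + 1) j)
      (Finset.mem_univ p), update_self, ← mul_assoc, ← pow_succ']
  congr 1
  refine Finset.prod_congr rfl fun j hj => ?_
  rw [update_of_ne (Finset.ne_of_mem_erase hj)]

theorem prod_X_pow_eq_monomial {k : ℕ} (f : Fin k → ℕ) :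
    (∏ j, X j ^ f j : MvPolynomial (Fin k) ℂ) = monomial (Finsupp.equivFunOnFinite.symm f) 1 := by
  rw [monomial_eq, C_1, one_mul, Finsupp.prod_fintype _ _ fun _ => pow_zero _]
  rfl

theorem prod_X_pow_mem_Rspace {k : ℕ} {f : Fin k → ℕ} (hf : ∀ j, f j ≤ 2) :
    (∏ j, X j ^ f j : MvPolynomial (Fin k) ℂ) ∈ Rspace k :=
  Submodule.subset_span ⟨Finsupp.equivFunOnFinite.symm f, hf, prod_X_pow_eq_monomial f⟩

theorem prod_X_pow_mem_span_Lset {k : ℕ} {f : Fin k → ℕ} (hf : ∀ j, f j ≤ 2) {i : ℕ}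
    (hi : ∀ j : Fin k, (j : ℕ) = k - 1 → f j = i) :
    (∏ j, X j ^ f j : MvPolynomial (Fin k) ℂ) ∈ Submodule.span ℂ (Lset k i) :=
  Submodule.subset_span ⟨Finsupp.equivFunOnFinite.symm f, hf, hi, prod_X_pow_eq_monomial f⟩

theorem update_two_le {k : ℕ} {f : Fin k → ℕ} (hf : ∀ j, f j ≤ 2) (p j : Fin k) :
    Function.update f p 2 j ≤ 2 := by
  rw [Function.update_apply]
  split_ifs
  exacts [le_rfl, hf j]

theorem rename_swap_prod_X_pow {k : ℕ} {f : Fin k → ℕ} {p q : Fin k} (h : f p = f q) :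
    rename (Equiv.swap p q) (∏ j, X j ^ f j : MvPolynomial (Fin k) ℂ) = ∏ j, X j ^ f j := by
  simp only [map_prod, map_pow, rename_X]
  rw [← Equiv.prod_comp (Equiv.swap p q) (fun j => (X j : MvPolynomial (Fin k) ℂ) ^ f j)]
  refine Finset.prod_congr rfl fun j _ => ?_
  rw [Equiv.swap_apply_def]
  split_ifs <;> simp_all

/-- A polynomial of `R_k` of the form `(z_{p-1} - z_p - 1) F`, with `F` symmetric in
`z_{p-1}` and `z_p`, admits a boundary decomposition. -/
theorem mul_mem_BDset {k : ℕ} [NeZero k] (η : ℝ) {p : Fin k} (hp : p ≠ 0)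
    {F : MvPolynomial (Fin k) ℂ} (hF : rename (Equiv.swap (p - 1) p) F = F)
    (hR : (X (p - 1) - X p - 1) * F ∈ Rspace k) :
    (X (p - 1) - X p - 1) * F ∈ BDset k η := by
  refine ⟨hR, Pi.single p F, ?_, ?_, fun i _ => ?_, ?_⟩
  · simp [Pi.single_eq_of_ne hp.symm]
  · simp [Pi.single_eq_of_ne hp.symm]
  · obtain rfl | hip := eq_or_ne i p
    · simpa using ⟨hF, hR⟩
    · simp [Pi.single_eq_of_ne hip]
  · rw [Finset.sum_eq_single p]
    · simp [Pi.single_eq_of_ne hp.symm]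
    · intro b _ hb
      simp [Pi.single_eq_of_ne hb]
    · simp [hp]

open Function in
theorem prod_X_pow_exchange_mem_BDset {k : ℕ} [NeZero k] (η : ℝ) {f : Fin k → ℕ}
    (hf : ∀ j, f j ≤ 2) {n : ℕ} (hn : n + 1 < k) (h₀ : f ⟨n, by omega⟩ = 1)
    (h₁ : f ⟨n + 1, hn⟩ = 1) :
    (∏ j, X j ^ update f ⟨n, by omega⟩ 2 j - ∏ j, X j ^ update f ⟨n + 1, hn⟩ 2 j
      - ∏ j, X j ^ f j : MvPolynomial (Fin k) ℂ) ∈ BDset k η := by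
  have hp : (⟨n + 1, hn⟩ : Fin k) ≠ 0 := by
    simp [Fin.ext_iff]
  have hpred : (⟨n + 1, hn⟩ : Fin k) - 1 = ⟨n, by omega⟩ := by
    rw [sub_eq_iff_eq_add, Fin.ext_iff, Fin.val_add, Fin.val_one', Nat.add_mod_mod,
      Nat.mod_eq_of_lt hn]
  have key : (X ((⟨n + 1, hn⟩ : Fin k) - 1) - X ⟨n + 1, hn⟩ - 1) * ∏ j, X j ^ f j =
      (∏ j, X j ^ update f ⟨n, by omega⟩ 2 j - ∏ j, X j ^ update f ⟨n + 1, hn⟩ 2 j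
        - ∏ j, X j ^ f j : MvPolynomial (Fin k) ℂ) := by
    rw [hpred, sub_mul, sub_mul, one_mul, X_mul_prod_X_pow, X_mul_prod_X_pow, h₀, h₁]
  rw [← key]
  refine mul_mem_BDset η hp (rename_swap_prod_X_pow ?_) ?_
  · rw [hpred, h₀, h₁]
  · rw [key]
    exact sub_mem (sub_mem (prod_X_pow_mem_Rspace (update_two_le hf _))
      (prod_X_pow_mem_Rspace (update_two_le hf _))) (prod_X_pow_mem_Rspace hf)

open Function in
theorem prod_X_pow_update_two_sub_mem {k : ℕ} [NeZero k] (η : ℝ) {f : Fin k → ℕ}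
    (hf : ∀ j, f j ≤ 2) (d n : ℕ) (hn : n + d + 1 = k)
    (h₁ : ∀ j : Fin k, n ≤ (j : ℕ) → f j = 1) :
    (∏ j, X j ^ update f ⟨n, by omega⟩ 2 j - C (d : ℂ) * ∏ j, X j ^ f j :
        MvPolynomial (Fin k) ℂ) ∈
      Submodule.span ℂ (BDset k η) ⊔ Submodule.span ℂ (Lset k 2) := by
  induction d generalizing n with
  | zero =>
    simp only [Nat.cast_zero, map_zero, zero_mul, sub_zero]
    refine Submodule.mem_sup_right (prod_X_pow_mem_span_Lset (update_two_le hf _) fun j hj => ?_)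
    rw [show j = ⟨n, by omega⟩ from Fin.ext (by simp only; omega), update_self]
  | succ d ih =>
    have h := ih (n + 1) (by omega) fun j hj => h₁ j (by omega)
    have h' := Submodule.mem_sup_left (T := Submodule.span ℂ (Lset k 2)) <| Submodule.subset_span <|
      prod_X_pow_exchange_mem_BDset η hf (n := n) (by omega)
        (h₁ _ le_rfl) (h₁ _ (Nat.le_succ n))
    convert add_mem h h' using 1
    push_cast
    rw [C_add, C_1]
    ring

theorem prod_X_pow_foil_up_mem {k : ℕ} [NeZero k] (η : ℝ) (d n : ℕ) (hn : n + d + 1 = k)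
    (e : Fin k → ℕ) (he : ∀ j, e j ≤ 2) :
    (∏ j : Fin k, X j ^ (if (j : ℕ) < n then e j else 1) - C (1 / (d.factorial : ℂ)) *
        ∏ j : Fin k, X j ^ (if (j : ℕ) < n then e j else if (j : ℕ) < k - 1 then 2 else 1) :
        MvPolynomial (Fin k) ℂ) ∈
      Submodule.span ℂ (BDset k η) ⊔ Submodule.span ℂ (Lset k 2) := by
  induction d generalizing n e with
  | zero =>
    convert Submodule.zero_mem _ using 1
    rw [Nat.factorial_zero, Nat.cast_one, div_one, C_1, one_mul, sub_eq_zero]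
    refine Finset.prod_congr rfl fun j _ => ?_
    congr 1
    split_ifs <;> omega
  | succ d ih =>
    have hd : (d : ℂ) + 1 ≠ 0 := Nat.cast_add_one_ne_zero d
    have h := ih (n + 1) (by omega) (Function.update e ⟨n, by omega⟩ 2) (update_two_le he _)
    have h' := prod_X_pow_update_two_sub_mem η
      (f := fun j : Fin k => if (j : ℕ) < n then e j else 1)
      (fun j => by split_ifs; exacts [he j, one_le_two]) (d + 1) n hn
      (fun j hj => if_neg (by omega))
    have e₁ : (fun j : Fin k => if (j : ℕ) < n + 1 then Function.update e ⟨n, by omega⟩ 2 j else 1)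
        = Function.update (fun j : Fin k => if (j : ℕ) < n then e j else 1) ⟨n, by omega⟩ 2 := by
      funext j
      simp only [Function.update_apply, Fin.ext_iff]
      split_ifs <;> omega
    have e₂ : (fun j : Fin k => if (j : ℕ) < n + 1 then Function.update e ⟨n, by omega⟩ 2 j
          else if (j : ℕ) < k - 1 then 2 else 1)
        = fun j : Fin k => if (j : ℕ) < n then e j else if (j : ℕ) < k - 1 then 2 else 1 := by
      funext j
      simp only [Function.update_apply, Fin.ext_iff]
      split_ifs <;> omega
    simp only [congrFun e₁, congrFun e₂] at h
    convert Submodule.smul_mem _ (1 / ((d : ℂ) + 1)) (sub_mem h h') using 1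
    rw [smul_eq_C_mul, sub_sub_sub_cancel_left, mul_sub, ← mul_assoc, ← mul_assoc, ← C_mul,
      ← C_mul]
    congr 1
    · push_cast
      rw [one_div_mul_cancel hd, C_1, one_mul]
    · rw [Nat.factorial_succ]
      push_cast
      rw [one_div_mul_one_div]

/-- Lemma 4.4 of the paper: for `1 ≤ i ≤ k` and exponents `i_j ∈ {0,1,2}`,
`(∏_{j=1}^{i−1} z_j^{i_j}) · (z_i⋯z_k − (1/(k−i)!) z_i²⋯z_{k−1}² z_k) ∈ BD_k + span(L_k²)`. -/
theorem foil_up (k : ℕ) [NeZero k] (η : ℝ) (hη : 0 < η)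
    (i : ℕ) (hi1 : 1 ≤ i) (hi2 : i ≤ k) (e : Fin k → ℕ) (he : ∀ j, e j ≤ 2) :
    (∏ j ∈ Finset.univ.filter (fun j : Fin k => (j : ℕ) < i - 1), X j ^ e j) *
        ((∏ j ∈ Finset.univ.filter (fun j : Fin k => i - 1 ≤ (j : ℕ)), X j) -
          C (1 / ((k - i).factorial : ℂ)) *
            ((∏ j ∈ Finset.univ.filter (fun j : Fin k => i - 1 ≤ (j : ℕ) ∧ (j : ℕ) < k - 1),
              X j ^ 2) * X (⟨k - 1, by omega⟩ : Fin k)))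
      ∈ Submodule.span ℂ (BDset k η) ⊔ Submodule.span ℂ (Lset k 2) := by
  convert prod_X_pow_foil_up_mem η (k - i) (i - 1) (by omega) e he using 1
  have hlast : (X (⟨k - 1, by omega⟩ : Fin k) : MvPolynomial (Fin k) ℂ) =
      ∏ j : Fin k, if (j : ℕ) = k - 1 then X j else 1 := by
    rw [Finset.prod_eq_single (⟨k - 1, by omega⟩ : Fin k)]
    · simp
    · exact fun b _ hb => if_neg fun h => hb (Fin.ext h)
    · simp
  rw [hlast, mul_sub, mul_left_comm, Finset.prod_filter, Finset.prod_filter, Finset.prod_filter,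
    ← Finset.prod_mul_distrib, ← Finset.prod_mul_distrib, ← Finset.prod_mul_distrib]
  congr 1
  · refine Finset.prod_congr rfl fun j _ => ?_
    split_ifs <;> first | omega | simp
  · congr 1
    refine Finset.prod_congr rfl fun j _ => ?_
    have := j.isLt
    split_ifs <;> first | omega | simp
end
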